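/- arXiv:2108.02364 — 2 statements merged into one kernel-verified Lean document; each statement's English description precedes it below -/
import Mathlib

section
/- Let t ≥ 4 and 2 ≤ s ≤ t, and let β = ⌊(t+1)/(s+1)⌋. There exists n₀ such that for all n ≥ n₀ the following holds: with G⋆ and K as in the extremal setup, if H is a connected component of G⋆ − K with exactly t+1 vertices, then β ≥ 2, H is isomorphic to \overline{H_{s,t}}, and e(H) = C(t,2) + β − 1. -/
open SimpleGraph

/-- `H` is a minor of `G` (branch-set definition). -/
def MinorOf {α β : Type} (H : SimpleGraph α) (G : SimpleGraph β) : Prop :=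
  ∃ φ : α → Set β,
    (∀ a, (G.induce (φ a)).Connected) ∧
    (Pairwise fun a b => Disjoint (φ a) (φ b)) ∧
    (∀ a b, H.Adj a b → ∃ x ∈ φ a, ∃ y ∈ φ b, G.Adj x y)

/-- Adjacency matrix over ℝ. -/
noncomputable def adjMat {V : Type} [Fintype V] (G : SimpleGraph V) : Matrix V V ℝ :=
  letI := Classical.decRel G.Adj
  SimpleGraph.adjMatrix ℝ G

theorem adjMat_herm {V : Type} [Fintype V] (G : SimpleGraph V) : (adjMat G).IsHermitian := by
  letI := Classical.decRel G.Adj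
  ext i j
  simp [adjMat, Matrix.conjTranspose_apply, SimpleGraph.adjMatrix_apply, SimpleGraph.adj_comm]

/-- Spectral radius = largest adjacency eigenvalue. -/
noncomputable def specRad {V : Type} [Fintype V] [DecidableEq V] (G : SimpleGraph V) : ℝ :=
  ⨆ i, (adjMat_herm G).eigenvalues i

/-- degree -/
noncomputable def deg {V : Type} (G : SimpleGraph V) (v : V) : ℕ := (G.neighborSet v).ncard

/-- number of edges -/
noncomputable def ecard {V : Type} (G : SimpleGraph V) : ℕ := G.edgeSet.ncard

/-- k disjoint copies of G -/
def copies (k : ℕ) {V : Type} (G : SimpleGraph V) : SimpleGraph (Fin k × V) :=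
  SimpleGraph.fromRel fun x y => x.1 = y.1 ∧ G.Adj x.2 y.2

/-- disjoint union -/
def gUnion {V W : Type} (G : SimpleGraph V) (H : SimpleGraph W) : SimpleGraph (V ⊕ W) :=
  SimpleGraph.fromRel fun x y =>
    (∃ a b, x = Sum.inl a ∧ y = Sum.inl b ∧ G.Adj a b) ∨
    (∃ a b, x = Sum.inr a ∧ y = Sum.inr b ∧ H.Adj a b)

/-- join -/
def gJoin {V W : Type} (G : SimpleGraph V) (H : SimpleGraph W) : SimpleGraph (V ⊕ W) :=
  SimpleGraph.fromRel fun x y =>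
    (∃ a b, x = Sum.inl a ∧ y = Sum.inl b ∧ G.Adj a b) ∨
    (∃ a b, x = Sum.inr a ∧ y = Sum.inr b ∧ H.Adj a b) ∨
    (∃ a b, x = Sum.inl a ∧ y = Sum.inr b)

/-- Petersen graph (Kneser graph K(5,2)). -/
def petersen : SimpleGraph {s : Finset (Fin 5) // s.card = 2} :=
  SimpleGraph.fromRel fun a b => Disjoint a.1 b.1

/-- star K_{1,m} -/
def starG (m : ℕ) : SimpleGraph (Fin 1 ⊕ Fin m) := completeBipartiteGraph (Fin 1) (Fin m)

/-- the star forest H_{s,t} -/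
def Hst (s t : ℕ) :
    SimpleGraph ((Fin ((t+1)/(s+1) - 1) × (Fin 1 ⊕ Fin s)) ⊕ (Fin 1 ⊕ Fin (t - ((t+1)/(s+1) - 1) * (s+1)))) :=
  gUnion (copies ((t+1)/(s+1) - 1) (starG s)) (starG (t - ((t+1)/(s+1) - 1) * (s+1)))

/-- subdivide the edge uv of G by a path through k new vertices -/
def subdividePath {V : Type} (G : SimpleGraph V) (u v : V) (k : ℕ) : SimpleGraph (V ⊕ Fin k) :=
  SimpleGraph.fromRel fun x y =>
    (∃ a b, x = Sum.inl a ∧ y = Sum.inl b ∧ G.Adj a b ∧ ¬(a = u ∧ b = v) ∧ ¬(a = v ∧ b = u)) ∨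
    (∃ i : Fin k, x = Sum.inl u ∧ y = Sum.inr i ∧ (i : ℕ) = 0) ∨
    (∃ i j : Fin k, x = Sum.inr i ∧ y = Sum.inr j ∧ (j : ℕ) = (i : ℕ) + 1) ∨
    (∃ i : Fin k, x = Sum.inr i ∧ y = Sum.inl v ∧ (i : ℕ) = k - 1)

/-- (s,t)-property -/
def HasSTProp (s t : ℕ) {V : Type} (G : SimpleGraph V) : Prop :=
  ∀ a b : ℕ, 1 ≤ a → 1 ≤ b → a + b = t + 1 → a ≤ min s ((t+1)/2) →
    ¬ MinorOf (completeBipartiteGraph (Fin a) (Fin b)) G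

/-- H_{a,b,c} -/
def Habc (a b c : ℕ) : SimpleGraph (Fin 3 ⊕ (Fin a ⊕ Fin b ⊕ Fin c)) :=
  SimpleGraph.fromRel fun x y =>
    (x = Sum.inl 0 ∧ y = Sum.inl 1) ∨
    (x = Sum.inl 0 ∧ ∃ i : Fin a, y = Sum.inr (Sum.inl i)) ∨
    (x = Sum.inl 0 ∧ ∃ i : Fin b, y = Sum.inr (Sum.inr (Sum.inl i))) ∨
    (x = Sum.inl 1 ∧ ∃ i : Fin a, y = Sum.inr (Sum.inl i)) ∨
    (x = Sum.inl 1 ∧ ∃ i : Fin c, y = Sum.inr (Sum.inr (Sum.inr i))) ∨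
    (x = Sum.inl 2 ∧ ∃ i : Fin b, y = Sum.inr (Sum.inr (Sum.inl i))) ∨
    (x = Sum.inl 2 ∧ ∃ i : Fin c, y = Sum.inr (Sum.inr (Sum.inr i)))

noncomputable def edgeDegSum {V : Type} (G H : SimpleGraph V) : ℕ :=
  ∑ᶠ e ∈ G.edgeSet, Sym2.lift ⟨fun u v => deg H u + deg H v, fun u v => by dsimp; ring⟩ e

namespace CTP

open Matrix

theorem specRad_psd {V : Type} [Fintype V] [DecidableEq V] (G : SimpleGraph V) :
    (specRad G • (1 : Matrix V V ℝ) - adjMat G).PosSemidef := by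
  have hA := adjMat_herm G
  have key := hA.spectral_theorem
  rw [Unitary.conjStarAlgAut_apply] at key
  set U := hA.eigenvectorUnitary with hU
  have h1 : specRad G • (1 : Matrix V V ℝ) - adjMat G =
      (U : Matrix V V ℝ) * (diagonal fun i => specRad G - hA.eigenvalues i) * (U : Matrix V V ℝ)ᴴ := by
    have hd : (diagonal fun i => specRad G - hA.eigenvalues i) =
        specRad G • (1 : Matrix V V ℝ) - diagonal hA.eigenvalues := by
      ext i j
      by_cases h : i = j
      · subst h; simp
      · simp [h]
    have hUU : (U : Matrix V V ℝ) * (U : Matrix V V ℝ)ᴴ = 1 := by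
      rw [← star_eq_conjTranspose]
      exact Unitary.coe_mul_star_self U
    rw [hd, mul_sub, sub_mul]
    congr 1
    rw [mul_smul_comm, smul_mul_assoc, mul_one, hUU]
  rw [h1]
  refine PosSemidef.mul_mul_conjTranspose_same (PosSemidef.diagonal ?_) _
  intro i
  have : hA.eigenvalues i ≤ specRad G := le_ciSup (f := hA.eigenvalues) (Set.finite_range _).bddAbove i
  simpa using this

theorem rayleigh {V : Type} [Fintype V] [DecidableEq V] (G : SimpleGraph V) (x : V → ℝ) :
    x ⬝ᵥ (adjMat G *ᵥ x) ≤ specRad G * (x ⬝ᵥ x) := by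
  have := (specRad_psd G).dotProduct_mulVec_nonneg x
  simp [sub_mulVec, smul_mulVec, dotProduct_sub] at this
  simpa using this

theorem adjMat_nonneg {V : Type} [Fintype V] (G : SimpleGraph V) (u v : V) : 0 ≤ adjMat G u v := by
  classical
  simp only [adjMat, SimpleGraph.adjMatrix_apply]
  split_ifs <;> norm_num

open Classical in
theorem adjMat_apply {V : Type} [Fintype V] (G : SimpleGraph V) (u v : V) :
    adjMat G u v = if G.Adj u v then 1 else 0 := by
  simp only [adjMat, SimpleGraph.adjMatrix_apply]

theorem exists_perron {V : Type} [Fintype V] [DecidableEq V] [Nonempty V] (G : SimpleGraph V) :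
    ∃ x : V → ℝ, (∀ v, 0 ≤ x v) ∧ (∃ v, x v ≠ 0) ∧ adjMat G *ᵥ x = specRad G • x := by
  have hA := adjMat_herm G
  obtain ⟨i, hi⟩ := exists_eq_ciSup_of_finite (f := hA.eigenvalues)
  have hi : hA.eigenvalues i = specRad G := hi
  have hv := hA.mulVec_eigenvectorBasis i
  set v : V → ℝ := ⇑(hA.eigenvectorBasis i) with hvdef
  have hvne : ∃ w, v w ≠ 0 := by
    by_contra hcon
    push Not at hcon
    have h0 : hA.eigenvectorBasis i = 0 := by
      ext w; exact hcon w
    have := hA.eigenvectorBasis.orthonormal.ne_zero i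
    exact this h0
  rw [hi] at hv
  refine ⟨fun w => |v w|, fun w => abs_nonneg _, ?_, ?_⟩
  · obtain ⟨w, hw⟩ := hvne
    exact ⟨w, by simpa using hw⟩
  set x : V → ℝ := fun w => |v w| with hx
  have hxx : x ⬝ᵥ x = v ⬝ᵥ v := by
    simp [dotProduct, hx]
  have h1 : v ⬝ᵥ (adjMat G *ᵥ v) = specRad G * (v ⬝ᵥ v) := by
    rw [hv, dotProduct_smul, smul_eq_mul]
  have h2 : v ⬝ᵥ (adjMat G *ᵥ v) ≤ x ⬝ᵥ (adjMat G *ᵥ x) := by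
    simp only [dotProduct, mulVec, Finset.mul_sum]
    refine Finset.sum_le_sum fun a _ => Finset.sum_le_sum fun b _ => ?_
    have : v a * (adjMat G a b * v b) ≤ |v a * (adjMat G a b * v b)| := le_abs_self _
    rw [abs_mul, abs_mul, abs_of_nonneg (adjMat_nonneg G a b)] at this
    exact this
  have h3 := rayleigh G x
  have h4 : x ⬝ᵥ ((specRad G • (1 : Matrix V V ℝ) - adjMat G) *ᵥ x) = 0 := by
    rw [sub_mulVec, smul_mulVec, one_mulVec, dotProduct_sub, dotProduct_smul, smul_eq_mul]
    rw [hxx] at *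
    linarith
  have h5 := ((specRad_psd G).dotProduct_mulVec_zero_iff x).1 (by simpa using h4)
  rw [sub_mulVec, smul_mulVec, one_mulVec, sub_eq_zero] at h5
  exact h5.symm

end CTP
namespace CTP

open Matrix

open Classical in
/-- sum of degrees -/
noncomputable def w1 {W : Type} [Fintype W] (H : SimpleGraph W) : ℕ := ∑ v, H.degree v

open Classical in
/-- sum of squared degrees -/
noncomputable def w2 {W : Type} [Fintype W] (H : SimpleGraph W) : ℕ := ∑ v, (H.degree v) ^ 2

open Classical in
/-- real degree vector -/
noncomputable def dv {W : Type} [Fintype W] (H : SimpleGraph W) : W → ℝ := fun v => H.degree v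

theorem dv_eq {W : Type} [Fintype W] (H : SimpleGraph W) (v : W) :
    ∑ u, adjMat H v u = dv H v := by
  classical
  simp only [adjMat_apply, dv, Finset.sum_boole]
  congr 2
  ext u; simp

theorem adjMat_symm {W : Type} [Fintype W] (H : SimpleGraph W) (u v : W) :
    adjMat H u v = adjMat H v u := by
  classical
  simp only [adjMat_apply, SimpleGraph.adj_comm]

/-- moving the matrix across the dot product -/
theorem dot_adj {W : Type} [Fintype W] (H : SimpleGraph W) (p q : W → ℝ) :
    p ⬝ᵥ (adjMat H *ᵥ q) = (adjMat H *ᵥ p) ⬝ᵥ q := by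
  rw [dotProduct_mulVec]
  congr 1
  ext u
  simp only [vecMul, mulVec, dotProduct]
  refine Finset.sum_congr rfl fun i _ => ?_
  rw [adjMat_symm, mul_comm]

theorem mulVec_mono {W : Type} [Fintype W] (H : SimpleGraph W) (p : W → ℝ) (C t : ℝ) (hC : 0 ≤ C)
    (hp : ∀ w, p w ≤ C) (hd : ∀ w, dv H w ≤ t) (w : W) : (adjMat H *ᵥ p) w ≤ t * C := by
  calc (adjMat H *ᵥ p) w = ∑ u, adjMat H w u * p u := rfl
    _ ≤ ∑ u, adjMat H w u * C :=
      Finset.sum_le_sum fun u _ => mul_le_mul_of_nonneg_left (hp u) (adjMat_nonneg H w u)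
    _ = dv H w * C := by rw [← Finset.sum_mul, dv_eq]
    _ ≤ t * C := mul_le_mul_of_nonneg_right (hd w) hC

theorem mulVec_nonneg' {W : Type} [Fintype W] (H : SimpleGraph W) (p : W → ℝ)
    (hp : ∀ w, 0 ≤ p w) (w : W) : 0 ≤ (adjMat H *ᵥ p) w :=
  Finset.sum_nonneg fun u _ => mul_nonneg (adjMat_nonneg H w u) (hp u)

theorem dv_nonneg {W : Type} [Fintype W] (H : SimpleGraph W) (w : W) : 0 ≤ dv H w := by
  simp [dv]

theorem dv_le {W : Type} [Fintype W] (t : ℕ) (hW : Fintype.card W = t + 1) (H : SimpleGraph W)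
    (w : W) : dv H w ≤ t := by
  classical
  have := H.degree_lt_card_verts w
  have : H.degree w ≤ t := by omega
  simp only [dv]
  exact_mod_cast this

theorem sum_dv {W : Type} [Fintype W] (H : SimpleGraph W) : ∑ w, dv H w = w1 H := by
  simp [dv, w1]

theorem dv_dot {W : Type} [Fintype W] (H : SimpleGraph W) : dv H ⬝ᵥ dv H = w2 H := by
  simp [dv, w2, dotProduct, sq]

theorem sum_mulVec {W : Type} [Fintype W] (H : SimpleGraph W) (p : W → ℝ) :
    ∑ w, (adjMat H *ᵥ p) w = dv H ⬝ᵥ p := by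
  have h1 : adjMat H *ᵥ (fun _ => (1 : ℝ)) = dv H := by
    ext w; simp [mulVec, dotProduct, dv_eq]
  have := dot_adj H (fun _ => 1) p
  rw [h1] at this
  rw [← this]
  simp [dotProduct]

theorem w2_le {W : Type} [Fintype W] (t : ℕ) (hW : Fintype.card W = t + 1) (H : SimpleGraph W) :
    w2 H ≤ (t + 1) * t ^ 2 := by
  classical
  unfold w2
  calc _ ≤ ∑ _v : W, t ^ 2 := Finset.sum_le_sum fun v _ => by
        have := H.degree_lt_card_verts v
        exact Nat.pow_le_pow_left (by omega) 2
    _ = _ := by simp [hW]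

theorem num {W : Type} [Fintype W] (t : ℕ) (hW : Fintype.card W = t + 1) (H H' : SimpleGraph W)
    (k ρ : ℝ) (hk : 0 < k) (hρ : (t + (t + 1) * t ^ 3 + (t + 1) * t ^ 2 + 2 : ℝ) ≤ ρ)
    (y : W → ℝ) (hy : ∀ w, 0 ≤ y w) (hyeq : ∀ w, ρ * y w = k + (adjMat H *ᵥ y) w)
    (hlt : w1 H < w1 H' ∨ (w1 H = w1 H' ∧ w2 H < w2 H')) :
    ∃ y' : W → ℝ, (∀ w, 0 ≤ y' w) ∧ (∀ w, ρ * y' w ≤ k + (adjMat H' *ᵥ y') w) ∧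
      ∑ w, y w < ∑ w, y' w := by
  have ht0 : (0 : ℝ) ≤ t := Nat.cast_nonneg t
  have hp3 : (0 : ℝ) ≤ (t + 1) * t ^ 3 := by positivity
  have hp2 : (0 : ℝ) ≤ (t + 1) * t ^ 2 := by positivity
  have hρ0 : 0 < ρ := by linarith
  have hρt : 0 < ρ - t := by linarith
  -- generic moment identity
  have mom : ∀ p : W → ℝ, ρ * (p ⬝ᵥ y) = k * (∑ w, p w) + (adjMat H *ᵥ p) ⬝ᵥ y := by
    intro p
    rw [← dot_adj]
    simp only [dotProduct, Finset.mul_sum, ← Finset.sum_add_distrib]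
    refine Finset.sum_congr rfl fun w _ => ?_
    have := hyeq w
    calc ρ * (p w * y w) = p w * (ρ * y w) := by ring
      _ = _ := by rw [this]; ring
  set d := dv H with hd
  set Y := ∑ w, y w with hY
  have hYnn : 0 ≤ Y := Finset.sum_nonneg fun w _ => hy w
  have e0 : ρ * Y = k * (t + 1) + d ⬝ᵥ y := by
    rw [hY, Finset.mul_sum, ← sum_mulVec H y]
    simp_rw [hyeq, Finset.sum_add_distrib]
    simp [hW]; ring
  have e1 : ρ * (d ⬝ᵥ y) = k * (w1 H) + (adjMat H *ᵥ d) ⬝ᵥ y := by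
    rw [mom, hd, sum_dv]
  have e2 : ρ * ((adjMat H *ᵥ d) ⬝ᵥ y) = k * (w2 H) + (adjMat H *ᵥ (adjMat H *ᵥ d)) ⬝ᵥ y := by
    rw [mom, sum_mulVec, hd, dv_dot]
  have bd : ∀ (p : W → ℝ) (C : ℝ), (∀ w, p w ≤ C) → p ⬝ᵥ y ≤ C * Y := by
    intro p C hp
    rw [hY, Finset.mul_sum]
    exact Finset.sum_le_sum fun w _ => mul_le_mul_of_nonneg_right (hp w) (hy w)
  have hdt := dv_le t hW H
  have b1 : d ⬝ᵥ y ≤ t * Y := bd _ _ hdt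
  have hAd := mulVec_mono H d t t ht0 hdt hdt
  have hAAd := mulVec_mono H _ (t * t) t (by positivity) hAd hdt
  have b3 := bd _ _ hAAd
  set Y3 := (adjMat H *ᵥ (adjMat H *ᵥ d)) ⬝ᵥ y with hY3
  have hY3lt : Y3 < k := by
    have h1 : (ρ - t) * Y ≤ k * (t + 1) := by linarith
    have h2 : (ρ - t) * Y3 ≤ k * ((t + 1) * t ^ 3) := by
      calc (ρ - t) * Y3 ≤ (ρ - t) * (t * (t * t) * Y) := mul_le_mul_of_nonneg_left b3 hρt.le
        _ = t ^ 3 * ((ρ - t) * Y) := by ring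
        _ ≤ t ^ 3 * (k * (t + 1)) := mul_le_mul_of_nonneg_left h1 (by positivity)
        _ = _ := by ring
    have h3 : k * ((t + 1) * t ^ 3) < (ρ - t) * k := by
      rw [mul_comm (ρ - t)]
      exact mul_lt_mul_of_pos_left (by linarith) hk
    exact lt_of_mul_lt_mul_left (lt_of_le_of_lt h2 h3) hρt.le
  set d' := dv H' with hd'
  set y' : W → ℝ := fun w => k / ρ + k / ρ ^ 2 * d' w + k / ρ ^ 3 * (adjMat H' *ᵥ d') w with hy'
  have hd'nn : ∀ w, 0 ≤ d' w := dv_nonneg H'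
  have hBd'nn := mulVec_nonneg' H' d' hd'nn
  have hBBd'nn := mulVec_nonneg' H' _ hBd'nn
  have hmul : ∀ w, (adjMat H' *ᵥ y') w = k / ρ * d' w + k / ρ ^ 2 * (adjMat H' *ᵥ d') w +
      k / ρ ^ 3 * (adjMat H' *ᵥ (adjMat H' *ᵥ d')) w := by
    intro w
    rw [hd', ← dv_eq H' w]
    simp only [hy', mulVec, dotProduct, Finset.mul_sum, ← Finset.sum_add_distrib]
    refine Finset.sum_congr rfl fun u _ => ?_
    simp only [mul_add, Finset.mul_sum]
    congr 1
    · congr 1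
      · ring
      · rw [hd']; ring
    · refine Finset.sum_congr rfl fun u _ => ?_
      rw [hd']; ring
  refine ⟨y', fun w => ?_, fun w => ?_, ?_⟩
  · have := hd'nn w
    have := hBd'nn w
    simp only [hy']
    positivity
  · rw [hmul]
    have h1 : ρ * y' w = k + (k / ρ * d' w + k / ρ ^ 2 * (adjMat H' *ᵥ d') w) := by
      simp only [hy']
      field_simp
      ring
    rw [h1]
    have h2 : 0 ≤ k / ρ ^ 3 * (adjMat H' *ᵥ (adjMat H' *ᵥ d')) w :=
      mul_nonneg (by positivity) (hBBd'nn w)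
    linarith
  · have hsum : ρ ^ 3 * ∑ w, y' w = k * (ρ ^ 2 * (t + 1) + ρ * w1 H' + w2 H') := by
      have : ∑ w, y' w = k / ρ * (t + 1) + k / ρ ^ 2 * w1 H' + k / ρ ^ 3 * w2 H' := by
        simp only [hy', Finset.sum_add_distrib, ← Finset.mul_sum]
        rw [sum_mulVec, hd', sum_dv, dv_dot]
        simp [hW]; ring
      rw [this]; field_simp
    have hsumY : ρ ^ 3 * Y = k * (ρ ^ 2 * (t + 1) + ρ * w1 H + w2 H) + Y3 := by
      have : ρ ^ 3 * Y = ρ ^ 2 * (ρ * Y) := by ring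
      rw [this, e0]
      have : ρ ^ 2 * (k * (t + 1) + d ⬝ᵥ y) = k * ρ ^ 2 * (t + 1) + ρ * (ρ * (d ⬝ᵥ y)) := by ring
      rw [this, e1]
      have : ρ * (k * (w1 H) + (adjMat H *ᵥ d) ⬝ᵥ y) = ρ * k * w1 H + ρ * ((adjMat H *ᵥ d) ⬝ᵥ y) := by
        ring
      rw [this, e2]; ring
    refine lt_of_mul_lt_mul_left ?_ (show 0 ≤ ρ ^ 3 by positivity)
    rw [hsum, hsumY]
    have main : (1 : ℝ) ≤ ρ * (w1 H' - w1 H) + (w2 H' - w2 H) := by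
      rcases hlt with h | ⟨h, h'⟩
      · have h1 : (1 : ℝ) ≤ w1 H' - w1 H := by
          have : (w1 H : ℝ) + 1 ≤ w1 H' := by exact_mod_cast h
          linarith
        have h2 : (w2 H : ℝ) ≤ (t + 1) * t ^ 2 := by exact_mod_cast w2_le t hW H
        have h3 : (0 : ℝ) ≤ w2 H' := Nat.cast_nonneg _
        have h4 : ρ * 1 ≤ ρ * ((w1 H' : ℝ) - w1 H) := mul_le_mul_of_nonneg_left h1 hρ0.le
        linarith
      · have h1 : (w2 H : ℝ) + 1 ≤ w2 H' := by exact_mod_cast h'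
        rw [h]; linarith
    have := mul_le_mul_of_nonneg_left main hk.le
    linarith

end CTP
namespace CTP

open Matrix

/-- replace the graph inside the range of `ι` by another graph -/
def repl {V W : Type} (G : SimpleGraph V) (ι : W ↪ V) (H' : SimpleGraph W) : SimpleGraph V where
  Adj u v := (G.Adj u v ∧ ¬ (u ∈ Set.range ι ∧ v ∈ Set.range ι)) ∨
    ∃ a b, ι a = u ∧ ι b = v ∧ H'.Adj a b
  symm := ⟨by
    rintro u v (⟨h, h'⟩ | ⟨a, b, ha, hb, hab⟩)
    · exact Or.inl ⟨h.symm, fun h'' => h' ⟨h''.2, h''.1⟩⟩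
    · exact Or.inr ⟨b, a, hb, ha, hab.symm⟩⟩
  loopless := ⟨by
    rintro u (⟨h, h'⟩ | ⟨a, b, ha, hb, hab⟩)
    · exact G.loopless.irrefl u h
    · exact hab.ne (ι.injective (ha.trans hb.symm))⟩

theorem repl_in {V W : Type} (G : SimpleGraph V) (ι : W ↪ V) (H' : SimpleGraph W) (a b : W) :
    (repl G ι H').Adj (ι a) (ι b) ↔ H'.Adj a b := by
  constructor
  · rintro (⟨_, h⟩ | ⟨a', b', ha, hb, hab⟩)
    · exact absurd ⟨⟨a, rfl⟩, ⟨b, rfl⟩⟩ h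
    · rw [← ι.injective ha, ← ι.injective hb]; exact hab
  · intro h
    exact Or.inr ⟨a, b, rfl, rfl, h⟩

theorem repl_out {V W : Type} (G : SimpleGraph V) (ι : W ↪ V) (H' : SimpleGraph W) (u v : V)
    (hv : v ∉ Set.range ι) : (repl G ι H').Adj u v ↔ G.Adj u v := by
  constructor
  · rintro (⟨h, _⟩ | ⟨a', b', ha, hb, hab⟩)
    · exact h
    · exact absurd ⟨b', hb⟩ hv
  · intro h
    exact Or.inl ⟨h, fun h' => hv h'.2⟩

theorem repl_out' {V W : Type} (G : SimpleGraph V) (ι : W ↪ V) (H' : SimpleGraph W) (u v : V)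
    (hv : u ∉ Set.range ι) : (repl G ι H').Adj u v ↔ G.Adj u v := by
  rw [SimpleGraph.adj_comm, repl_out _ _ _ _ _ hv, SimpleGraph.adj_comm]

/-- the situation of the theorem -/
structure Setup {V W : Type} [Fintype W] (s t : ℕ) (G : SimpleGraph V) (K : Finset V)
    (ι : W ↪ V) : Prop where
  hs : 2 ≤ s
  hst : s ≤ t
  cardK : K.card = s - 1
  clique : G.IsClique (↑K : Set V)
  dom : ∀ v : V, v ∉ K → ∀ u ∈ K, G.Adj u v
  notK : ∀ w, ι w ∉ K
  closed : ∀ w v, v ∉ K → G.Adj (ι w) v → v ∈ Set.range ι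
  cardW : Fintype.card W = t + 1

theorem Setup.domAll {V W : Type} [Fintype W] {s t : ℕ} {G : SimpleGraph V} {K : Finset V}
    {ι : W ↪ V} (S : Setup s t G K ι) {u v : V} (hu : u ∈ K) (huv : u ≠ v) : G.Adj u v := by
  by_cases hv : v ∈ K
  · exact S.clique hu hv huv
  · exact S.dom v hv u hu

theorem sum_split {V W : Type} [Fintype V] [Fintype W] (ι : W ↪ V) (f : V → ℝ)
    (P : Finset V) (hP : ∀ v, v ∈ P ↔ v ∉ Set.range ι) :
    ∑ v, f v = ∑ w, f (ι w) + ∑ v ∈ P, f v := by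
  classical
  have h1 : ∑ w, f (ι w) = ∑ v ∈ Finset.univ.map ι, f v := by
    rw [Finset.sum_map]
  rw [h1, ← Finset.sum_union]
  · refine Finset.sum_congr ?_ fun _ _ => rfl
    ext v
    by_cases h : v ∈ Set.range ι
    · simpa [hP] using Or.inl h
    · simpa [hP] using Or.inr (by simpa using h)
  · rw [Finset.disjoint_left]
    intro v hv hv'
    rw [hP] at hv'
    exact hv' (by simpa using hv)

theorem spec_cmp {V W : Type} [Fintype V] [DecidableEq V] [Fintype W] {s t : ℕ}
    {G : SimpleGraph V} {K : Finset V} {ι : W ↪ V} (S : Setup s t G K ι)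
    (H' : SimpleGraph W)
    (hn : (t + (t + 1) * t ^ 3 + (t + 1) * t ^ 2 + 2) ^ 2 + s ≤ Fintype.card V)
    (hsp : specRad (repl G ι H') ≤ specRad G) :
    ¬ (w1 (G.comap ι) < w1 H' ∨ (w1 (G.comap ι) = w1 H' ∧ w2 (G.comap ι) < w2 H')) := by
  classical
  intro hlt
  have hs := S.hs
  obtain ⟨u0, hu0⟩ : K.Nonempty := by
    rw [← Finset.card_pos, S.cardK]; omega
  have : Nonempty V := ⟨u0⟩
  obtain ⟨x, hx0, ⟨v0, hv0⟩, hAx⟩ := exists_perron G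
  set ρ := specRad G with hρdef
  have hAx' : ∀ v, ∑ u, adjMat G v u * x u = ρ * x v := fun v => congrFun hAx v
  have hv0pos : 0 < x v0 := lt_of_le_of_ne (hx0 v0) (Ne.symm hv0)
  -- K values
  have hKsum : ∀ u ∈ K, ∑ v, x v = (ρ + 1) * x u := by
    intro u hu
    have h1 := hAx' u
    have h2 : ∀ v, adjMat G u v * x v = x v - if v = u then x u else 0 := by
      intro v
      rw [adjMat_apply]
      by_cases h : v = u
      · subst h; simp
      · simp [S.domAll hu (Ne.symm h), h]
    simp_rw [h2, Finset.sum_sub_distrib] at h1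
    simp at h1
    linarith
  have hSpos : 0 < ∑ v, x v := Finset.sum_pos' (fun v _ => hx0 v) ⟨v0, Finset.mem_univ _, hv0pos⟩
  set c := x u0 with hc
  have hcpos : 0 < c := by
    refine lt_of_le_of_ne (hx0 u0) fun h => ?_
    have := hKsum u0 hu0
    rw [← hc, ← h] at this
    simp at this; linarith
  have hρ1 : 0 < ρ + 1 := by
    have := hKsum u0 hu0
    rw [this] at hSpos
    exact pos_of_mul_pos_left hSpos hcpos.le
  have hKc : ∀ u ∈ K, x u = c := by
    intro u hu
    have h1 := hKsum u hu
    rw [hKsum u0 hu0] at h1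
    exact (mul_left_cancel₀ hρ1.ne' h1).symm
  have hge : ∀ v, v ∉ K → c ≤ ρ * x v := by
    intro v hv
    rw [← hAx' v]
    have : adjMat G v u0 * x u0 ≤ ∑ u, adjMat G v u * x u :=
      Finset.single_le_sum (f := fun u => adjMat G v u * x u)
        (fun u _ => mul_nonneg (adjMat_nonneg _ _ _) (hx0 u)) (Finset.mem_univ u0)
    rw [adjMat_apply, if_pos (S.dom v hv u0 hu0).symm, one_mul] at this
    exact this
  have hW0 : 0 < Fintype.card W := by rw [S.cardW]; omega
  obtain ⟨wz⟩ := Fintype.card_pos_iff.1 hW0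
  have hρ0 : 0 < ρ := by
    have h1 := hge (ι wz) (S.notK wz)
    exact pos_of_mul_pos_left (lt_of_lt_of_le hcpos h1) (hx0 _)
  have hρ2 : ((Fintype.card V - (s - 1) : ℕ) : ℝ) ≤ ρ ^ 2 := by
    have h1 : ∑ v ∈ Kᶜ, x v ≤ ρ * c := by
      rw [← hAx' u0]
      calc ∑ v ∈ Kᶜ, x v = ∑ v ∈ Kᶜ, adjMat G u0 v * x v := by
            refine Finset.sum_congr rfl fun v hv => ?_
            rw [adjMat_apply, if_pos (S.dom v (by simpa using hv) u0 hu0), one_mul]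
        _ ≤ _ := Finset.sum_le_univ_sum_of_nonneg
            (fun u => mul_nonneg (adjMat_nonneg _ _ _) (hx0 u))
    have h2 : ∑ v ∈ Kᶜ, c ≤ ρ * ∑ v ∈ Kᶜ, x v := by
      rw [Finset.mul_sum]
      exact Finset.sum_le_sum fun v hv => hge v (by simpa using hv)
    rw [Finset.sum_const, Finset.card_compl, S.cardK, nsmul_eq_mul] at h2
    have h3 : ρ * ∑ v ∈ Kᶜ, x v ≤ ρ * (ρ * c) := mul_le_mul_of_nonneg_left h1 hρ0.le
    have h4 : ((Fintype.card V - (s - 1) : ℕ) : ℝ) * c ≤ ρ ^ 2 * c := by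
      calc _ ≤ _ := h2.trans h3
        _ = _ := by ring
    exact le_of_mul_le_mul_right h4 hcpos
  have hρN : (t + (t + 1) * t ^ 3 + (t + 1) * t ^ 2 + 2 : ℝ) ≤ ρ := by
    have h1 : (t + (t + 1) * t ^ 3 + (t + 1) * t ^ 2 + 2) ^ 2 ≤ Fintype.card V - (s - 1) := by omega
    have h2 : ((t + (t + 1) * t ^ 3 + (t + 1) * t ^ 2 + 2 : ℝ)) ^ 2 ≤
        ((Fintype.card V - (s - 1) : ℕ) : ℝ) := by exact_mod_cast h1
    exact le_of_sq_le_sq (h2.trans hρ2) hρ0.le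
  -- splitting
  set P : Finset V := Finset.univ.filter fun v => v ∉ Set.range ι with hPdef
  have hP : ∀ v, v ∈ P ↔ v ∉ Set.range ι := by simp [hPdef]
  have hKP : K ⊆ P := by
    intro v hv
    rw [hP]
    rintro ⟨w, rfl⟩
    exact S.notK w hv
  set k : ℝ := (s - 1 : ℕ) * c with hk
  have hkpos : 0 < k := by
    have : (0 : ℝ) < (s - 1 : ℕ) := by exact_mod_cast (by omega : 0 < s - 1)
    positivity
  have hPsum : ∀ w, ∑ v ∈ P, adjMat G (ι w) v * x v = k := by
    intro w
    rw [← Finset.sum_subset hKP]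
    · have : ∀ v ∈ K, adjMat G (ι w) v * x v = c := by
        intro v hv
        rw [adjMat_apply, if_pos (S.dom _ (S.notK w) v hv).symm, one_mul, hKc v hv]
      rw [Finset.sum_congr rfl this, Finset.sum_const, S.cardK, nsmul_eq_mul]
    · intro v hv hvK
      rw [adjMat_apply, if_neg, zero_mul]
      intro h
      exact (hP v).1 hv (S.closed w v hvK h)
  have hyeq : ∀ w, ρ * x (ι w) = k + (adjMat (G.comap ι) *ᵥ (fun w => x (ι w))) w := by
    intro w
    rw [← hAx' (ι w), sum_split ι _ P hP, hPsum, add_comm]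
    congr 1
  obtain ⟨y', hy'0, hy'1, hy'2⟩ := num t S.cardW (G.comap ι) H' k ρ hkpos hρN
    (fun w => x (ι w)) (fun w => hx0 _) hyeq hlt
  set x' : V → ℝ := Function.extend ι y' x with hx'
  have hxi : ∀ w, x' (ι w) = y' w := fun w => ι.injective.extend_apply _ _ _
  have hxo : ∀ v, v ∉ Set.range ι → x' v = x v := fun v hv => Function.extend_apply' _ _ _ hv
  have hx'0 : ∀ v, 0 ≤ x' v := by
    intro v
    by_cases hv : v ∈ Set.range ι
    · obtain ⟨w, rfl⟩ := hv
      rw [hxi]; exact hy'0 w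
    · rw [hxo v hv]; exact hx0 v
  set G' := repl G ι H' with hG'
  have hcalc : ∀ v, (adjMat G' *ᵥ x') v =
      ∑ w, adjMat G' v (ι w) * y' w + ∑ u ∈ P, adjMat G v u * x u := by
    intro v
    have : (adjMat G' *ᵥ x') v = ∑ u, adjMat G' v u * x' u := rfl
    rw [this, sum_split ι _ P hP]
    congr 1
    · simp_rw [hxi]
    · refine Finset.sum_congr rfl fun u hu => ?_
      rw [hxo u ((hP u).1 hu), adjMat_apply, adjMat_apply, hG', repl_out _ _ _ _ _ ((hP u).1 hu)]
  have hpt : ∀ v, ρ * x' v ≤ (adjMat G' *ᵥ x') v ∧ (v ∈ K → ρ * x' v < (adjMat G' *ᵥ x') v) := by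
    intro v
    by_cases hv : v ∈ Set.range ι
    · obtain ⟨w, rfl⟩ := hv
      refine ⟨?_, fun h => absurd h (S.notK w)⟩
      rw [hcalc, hPsum, hxi, add_comm]
      refine (hy'1 w).trans_eq ?_
      congr 1
      refine Finset.sum_congr rfl fun w' _ => ?_
      simp only [adjMat_apply, hG', repl_in]
    · rw [hcalc, hxo v hv, ← hAx' v, sum_split ι _ P hP]
      have hadj : ∀ w, adjMat G' v (ι w) = adjMat G v (ι w) := by
        intro w
        rw [adjMat_apply, adjMat_apply, hG', repl_out' _ _ _ _ _ hv]
      simp_rw [hadj]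
      by_cases hvK : v ∈ K
      · have h1 : ∀ w, adjMat G v (ι w) = 1 := by
          intro w
          rw [adjMat_apply, if_pos (S.dom _ (S.notK w) v hvK)]
        simp_rw [h1, one_mul]
        constructor
        · linarith
        · intro _; linarith
      · have h1 : ∀ w, adjMat G v (ι w) = 0 := by
          intro w
          rw [adjMat_apply, if_neg]
          intro h
          exact hv (S.closed w v hvK h.symm)
        simp_rw [h1, zero_mul]
        exact ⟨le_refl _, fun h => absurd h hvK⟩
  have hu0r : u0 ∉ Set.range ι := (hP u0).1 (hKP hu0)
  have hlt1 : ρ * (x' ⬝ᵥ x') < x' ⬝ᵥ (adjMat G' *ᵥ x') := by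
    simp only [dotProduct, Finset.mul_sum]
    refine Finset.sum_lt_sum (fun v _ => ?_) ⟨u0, Finset.mem_univ _, ?_⟩
    · have := mul_le_mul_of_nonneg_left (hpt v).1 (hx'0 v)
      linarith
    · have h0 : 0 < x' u0 := by rw [hxo u0 hu0r]; exact hcpos
      have := mul_lt_mul_of_pos_left ((hpt u0).2 hu0) h0
      linarith
  have hR := rayleigh G' x'
  have hnn : 0 ≤ x' ⬝ᵥ x' := Finset.sum_nonneg fun v _ => mul_nonneg (hx'0 v) (hx'0 v)
  have := mul_le_mul_of_nonneg_right hsp hnn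
  linarith

end CTP
namespace CTP

/-- every nonempty set of at most `s` vertices has an edge of `F` leaving it -/
def Expands {W : Type} (s : ℕ) (F : SimpleGraph W) : Prop :=
  ∀ A : Finset W, A.Nonempty → A.card ≤ s → ∃ a ∈ A, ∃ b, b ∉ A ∧ F.Adj a b

theorem sing_conn {V : Type} (G : SimpleGraph V) (v : V) :
    (G.induce ({v} : Set V)).Connected where
  preconnected := by
    rintro ⟨a, ha⟩ ⟨b, hb⟩
    have ha' : a = v := ha
    have hb' : b = v := hb
    subst ha'
    subst hb'
    exact SimpleGraph.Reachable.refl _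
  nonempty := ⟨⟨v, rfl⟩⟩

theorem expands_of_minorFree {V W : Type} [DecidableEq V] [Fintype W] {s t : ℕ}
    {G : SimpleGraph V} {K : Finset V} {ι : W ↪ V} (S : Setup s t G K ι)
    (hG : ¬ MinorOf (completeBipartiteGraph (Fin s) (Fin t)) G) :
    Expands s (G.comap ι)ᶜ := by
  classical
  intro A hA hAs
  by_contra hcon
  push Not at hcon
  apply hG
  have hApos := hA.card_pos
  have hs := S.hs
  have hst := S.hst
  obtain ⟨K1, hK1, hK1c⟩ := Finset.exists_subset_card_eq (s := K) (n := s - A.card)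
    (by rw [S.cardK]; omega)
  set L : Finset V := A.map ι ∪ K1 with hL
  set R : Finset V := Aᶜ.map ι ∪ (K \ K1) with hR
  have hdis : ∀ (B : Finset W) (K' : Finset V), K' ⊆ K → Disjoint (B.map ι) K' := by
    intro B K' hK'
    rw [Finset.disjoint_left]
    intro v hv hv'
    obtain ⟨w, _, rfl⟩ := Finset.mem_map.1 hv
    exact S.notK w (hK' hv')
  have hLc : L.card = s := by
    rw [hL, Finset.card_union_of_disjoint (hdis _ _ hK1), Finset.card_map, hK1c]; omega
  have hRc : R.card = t := by
    rw [hR, Finset.card_union_of_disjoint (hdis _ _ Finset.sdiff_subset), Finset.card_map,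
      Finset.card_compl, S.cardW, Finset.card_sdiff_of_subset hK1, hK1c, S.cardK]
    omega
  have hadj : ∀ u ∈ L, ∀ v ∈ R, u ≠ v ∧ G.Adj u v := by
    intro u hu v hv
    rw [hL, Finset.mem_union] at hu
    rw [hR, Finset.mem_union] at hv
    rcases hu with hu | hu
    · obtain ⟨a, ha, rfl⟩ := Finset.mem_map.1 hu
      rcases hv with hv | hv
      · obtain ⟨b, hb, rfl⟩ := Finset.mem_map.1 hv
        rw [Finset.mem_compl] at hb
        have hab : a ≠ b := fun h => hb (h ▸ ha)
        have h1 := hcon a ha b hb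
        rw [SimpleGraph.compl_adj] at h1
        push Not at h1
        have h2 := h1 hab
        rw [SimpleGraph.comap_adj] at h2
        exact ⟨h2.ne, h2⟩
      · have := (S.dom _ (S.notK a) v (Finset.mem_sdiff.1 hv).1).symm
        exact ⟨this.ne, this⟩
    · have huv : u ≠ v := by
        rcases hv with hv | hv
        · obtain ⟨b, hb, rfl⟩ := Finset.mem_map.1 hv
          rintro rfl
          exact S.notK b (hK1 hu)
        · rintro rfl
          exact (Finset.mem_sdiff.1 hv).2 hu
      exact ⟨huv, S.domAll (hK1 hu) huv⟩
  let eL := L.equivFinOfCardEq hLc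
  let eR := R.equivFinOfCardEq hRc
  let p : Fin s ⊕ Fin t → V := Sum.elim (fun i => (eL.symm i : V)) (fun j => (eR.symm j : V))
  have hp : Function.Injective p := by
    rintro (i | i) (j | j) h
    · have : eL.symm i = eL.symm j := Subtype.ext h
      rw [eL.symm.injective this]
    · exact absurd h (hadj _ (eL.symm i).2 _ (eR.symm j).2).1
    · exact absurd h.symm (hadj _ (eL.symm j).2 _ (eR.symm i).2).1
    · have : eR.symm i = eR.symm j := Subtype.ext h
      rw [eR.symm.injective this]
  refine ⟨fun a => {p a}, fun a => ?_, fun a b hab => ?_, ?_⟩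
  · exact sing_conn G (p a)
  · simpa using fun h => hab (hp h)
  · rintro (i | i) (j | j) h
    · simp at h
    · exact ⟨_, rfl, _, rfl, (hadj _ (eL.symm i).2 _ (eR.symm j).2).2⟩
    · exact ⟨_, rfl, _, rfl, (hadj _ (eL.symm j).2 _ (eR.symm i).2).2.symm⟩
    · simp at h

/-- a connected set avoiding an edge cut -/
theorem connected_subset {V : Type} (G : SimpleGraph V) (X T : Set V) (hX : (G.induce X).Connected)
    (hT : ∀ u ∈ X, ∀ v ∈ X, u ∈ T → G.Adj u v → v ∈ T) (u : V) (hu : u ∈ X) (huT : u ∈ T) :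
    X ⊆ T := by
  intro v hv
  obtain ⟨p⟩ := hX.preconnected ⟨u, hu⟩ ⟨v, hv⟩
  have key : ∀ (a b : X), (G.induce X).Walk a b → a.1 ∈ T → b.1 ∈ T := by
    intro a b q
    induction q with
    | nil => exact id
    | cons h _ ih => exact fun ha => ih (hT _ (Subtype.prop _) _ (Subtype.prop _) ha h)
  exact key _ _ p huT

theorem repl_minorFree {V W : Type} [DecidableEq V] [Fintype W] {s t : ℕ}
    {G : SimpleGraph V} {K : Finset V} {ι : W ↪ V} (S : Setup s t G K ι)
    (hG : ¬ MinorOf (completeBipartiteGraph (Fin s) (Fin t)) G) (H' : SimpleGraph W)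
    (hH' : Expands s H'ᶜ) :
    ¬ MinorOf (completeBipartiteGraph (Fin s) (Fin t)) (repl G ι H') := by
  classical
  rintro ⟨φ, hconn, hdisj, hadj⟩
  have hs := S.hs
  have hst := S.hst
  have hne : ∀ a, (φ a).Nonempty := fun a => by
    obtain ⟨x⟩ := (hconn a).nonempty
    exact ⟨x.1, x.2⟩
  have huniq : ∀ a b x, x ∈ φ a → x ∈ φ b → a = b := by
    intro a b x ha hb
    by_contra h
    exact Set.disjoint_left.1 (hdisj h) ha hb
  set X : Finset (Fin s ⊕ Fin t) := Finset.univ.filter fun a => ∀ v ∈ φ a, v ∉ K with hX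
  have hXm : ∀ a, a ∈ X ↔ ∀ v ∈ φ a, v ∉ K := by simp [hX]
  have hXn : ∀ a, a ∉ X → ∃ v, v ∈ φ a ∧ v ∈ K := by
    intro a ha
    rw [hXm] at ha
    push Not at ha
    exact ha
  have hg : ∃ g : Fin s ⊕ Fin t → V, ∀ a, g a ∈ φ a ∧ (a ∉ X → g a ∈ K) := by
    have : ∀ a, ∃ v, v ∈ φ a ∧ (a ∉ X → v ∈ K) := by
      intro a
      by_cases ha : a ∈ X
      · obtain ⟨v, hv⟩ := hne a
        exact ⟨v, hv, fun h => absurd ha h⟩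
      · obtain ⟨v, hv, hv'⟩ := hXn a ha
        exact ⟨v, hv, fun _ => hv'⟩
    choose g hg using this
    exact ⟨g, hg⟩
  obtain ⟨g, hg⟩ := hg
  have hginj : Function.Injective g := fun a b hab =>
    huniq a b (g a) (hg a).1 (hab ▸ (hg b).1)
  have hXc : Xᶜ.card ≤ s - 1 := by
    rw [← S.cardK, ← Finset.card_image_of_injective _ hginj]
    refine Finset.card_le_card fun v hv => ?_
    obtain ⟨a, ha, rfl⟩ := Finset.mem_image.1 hv
    exact (hg a).2 (by simpa using ha)
  by_cases hcase : ∀ a ∈ X, ∀ v ∈ φ a, v ∉ Set.range ι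
  · -- transfer to G
    apply hG
    obtain ⟨ψ, hψ1, hψ2⟩ : ∃ ψ : Fin s ⊕ Fin t → Set V, (∀ a ∈ X, ψ a = φ a) ∧
        (∀ a, a ∉ X → ψ a = {g a}) :=
      ⟨fun a => if a ∈ X then φ a else {g a}, fun a ha => if_pos ha, fun a ha => if_neg ha⟩
    have hgψ : ∀ a, g a ∈ ψ a := by
      intro a
      by_cases ha : a ∈ X
      · rw [hψ1 a ha]; exact (hg a).1
      · rw [hψ2 a ha]; rfl
    refine ⟨ψ, fun a => ?_, fun a b hab => ?_, ?_⟩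
    · by_cases ha : a ∈ X
      · rw [hψ1 a ha]
        have : G.induce (φ a) = (repl G ι H').induce (φ a) := by
          ext x y
          simp only [SimpleGraph.comap_adj]
          exact (repl_out _ _ _ _ _ (hcase a ha _ y.2)).symm
        rw [this]; exact hconn a
      · rw [hψ2 a ha]
        exact sing_conn G (g a)
    · have hsub : ∀ a, ψ a ⊆ φ a := by
        intro a
        by_cases ha : a ∈ X
        · rw [hψ1 a ha]
        · rw [hψ2 a ha]; simpa using (hg a).1
      exact (hdisj hab).mono (hsub a) (hsub b)
    · intro a b hab
      by_cases ha : a ∈ X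
      · by_cases hb : b ∈ X
        · rw [hψ1 a ha, hψ1 b hb]
          obtain ⟨x, hx, y, hy, hxy⟩ := hadj a b hab
          exact ⟨x, hx, y, hy, (repl_out _ _ _ _ _ (hcase b hb _ hy)).1 hxy⟩
        · refine ⟨g a, hgψ a, g b, hgψ b, ?_⟩
          exact (S.domAll ((hg b).2 hb) (fun h => hab.ne (hginj h).symm)).symm
      · refine ⟨g a, hgψ a, g b, hgψ b, ?_⟩
        exact S.domAll ((hg a).2 ha) (fun h => hab.ne (hginj h))
  · push Not at hcase
    obtain ⟨a0, ha0, v0, hv0, hv0r⟩ := hcase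
    have hin : ∀ a ∈ X, ∀ u ∈ φ a, u ∈ Set.range ι → φ a ⊆ Set.range ι := by
      intro a ha u hu hur
      refine connected_subset _ _ _ (hconn a) ?_ u hu hur
      intro x hx y hy hxr hxy
      by_contra hyr
      rw [repl_out _ _ _ _ _ hyr] at hxy
      obtain ⟨w, rfl⟩ := hxr
      exact hyr (S.closed w y ((hXm a).1 ha y hy) hxy)
    have hstep : ∀ a ∈ X, ∀ b ∈ X, (completeBipartiteGraph (Fin s) (Fin t)).Adj a b →
        φ a ⊆ Set.range ι → φ b ⊆ Set.range ι := by
      intro a ha b hb hab hsub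
      obtain ⟨x, hx, y, hy, hxy⟩ := hadj a b hab
      refine hin b hb y hy ?_
      by_contra hyr
      rw [repl_out _ _ _ _ _ hyr] at hxy
      obtain ⟨w, rfl⟩ := hsub hx
      exact hyr (S.closed w y ((hXm b).1 hb y hy) hxy)
    have hl : ∃ i, Sum.inl i ∈ X := by
      by_contra hcon
      push Not at hcon
      have : (Finset.univ.map (Function.Embedding.inl : Fin s ↪ Fin s ⊕ Fin t)) ⊆ Xᶜ := by
        intro a ha
        obtain ⟨i, _, rfl⟩ := Finset.mem_map.1 ha
        simpa using hcon i
      have := Finset.card_le_card this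
      simp at this
      omega
    have hr : ∃ i, Sum.inr i ∈ X := by
      by_contra hcon
      push Not at hcon
      have : (Finset.univ.map (Function.Embedding.inr : Fin t ↪ Fin s ⊕ Fin t)) ⊆ Xᶜ := by
        intro a ha
        obtain ⟨i, _, rfl⟩ := Finset.mem_map.1 ha
        simpa using hcon i
      have := Finset.card_le_card this
      simp at this
      omega
    obtain ⟨il, hil⟩ := hl
    obtain ⟨ir, hir⟩ := hr
    have h0 := hin a0 ha0 v0 hv0 hv0r
    have hboth : φ (Sum.inl il) ⊆ Set.range ι ∧ φ (Sum.inr ir) ⊆ Set.range ι := by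
      rcases a0 with i | i
      · have h1 := hstep _ ha0 _ hir (by simp) h0
        exact ⟨hstep _ hir _ hil (by simp) h1, h1⟩
      · have h1 := hstep _ ha0 _ hil (by simp) h0
        exact ⟨h1, hstep _ hil _ hir (by simp) h1⟩
    have hall : ∀ a ∈ X, φ a ⊆ Set.range ι := by
      rintro (i | i) hi
      · exact hstep _ hir _ hi (by simp) hboth.2
      · exact hstep _ hil _ hi (by simp) hboth.1
    have hXcard : t + 1 ≤ X.card := by
      have h1 := Finset.card_add_card_compl X
      simp only [Fintype.card_sum, Fintype.card_fin] at h1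
      omega
    have himg : X.image g = Finset.univ.map ι := by
      apply Finset.eq_of_subset_of_card_le
      · intro v hv
        obtain ⟨a, ha, rfl⟩ := Finset.mem_image.1 hv
        simpa using hall a ha (hg a).1
      · rw [Finset.card_image_of_injective _ hginj, Finset.card_map, Finset.card_univ, S.cardW]
        exact hXcard
    have hsurj : ∀ w, ∃ a ∈ X, g a = ι w := by
      intro w
      have : ι w ∈ X.image g := by rw [himg]; simp
      simpa using this
    have hsing : ∀ a ∈ X, ∀ v ∈ φ a, v = g a := by
      intro a ha v hv
      obtain ⟨w, rfl⟩ := hall a ha hv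
      obtain ⟨b, hb, hbw⟩ := hsurj w
      have := huniq a b (ι w) hv (hbw ▸ (hg b).1)
      rw [this, hbw]
    set A : Finset W := Finset.univ.filter fun w => ∃ i, Sum.inl i ∈ X ∧ g (Sum.inl i) = ι w with hA
    have hAne : A.Nonempty := by
      obtain ⟨w, hw⟩ := hall _ hil (hg _).1
      exact ⟨w, by simp only [hA, Finset.mem_filter, Finset.mem_univ, true_and]; exact ⟨il, hil, hw.symm⟩⟩
    have hAc : A.card ≤ s := by
      have : A.map ι ⊆ Finset.univ.image fun i : Fin s => g (Sum.inl i) := by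
        intro v hv
        obtain ⟨w, hw, rfl⟩ := Finset.mem_map.1 hv
        obtain ⟨i, _, hi⟩ := (Finset.mem_filter.1 hw).2
        exact Finset.mem_image.2 ⟨i, Finset.mem_univ _, hi⟩
      have h1 := Finset.card_le_card this
      rw [Finset.card_map] at h1
      refine h1.trans (Finset.card_image_le.trans ?_)
      simp
    obtain ⟨a, ha, b, hb, hab⟩ := hH' A hAne hAc
    obtain ⟨i, hiX, hi⟩ := (Finset.mem_filter.1 ha).2
    obtain ⟨j, hjX, hj⟩ := hsurj b
    rcases j with j | j
    · exact hb (by simp only [hA, Finset.mem_filter, Finset.mem_univ, true_and]; exact ⟨j, hjX, hj⟩)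
    · obtain ⟨x, hx, y, hy, hxy⟩ := hadj (Sum.inl i) (Sum.inr j) (by simp)
      rw [hsing _ hiX x hx, hsing _ hjX y hy, hi, hj, repl_in] at hxy
      exact ((SimpleGraph.compl_adj _ _ _).1 hab).2 hxy

end CTP
namespace CTP

open Classical in
theorem sq_lemma {I : Type} (T : Finset I) (f : I → ℕ) :
    ∑ i ∈ T, f i ^ 2 ≤ (∑ i ∈ T, f i) ^ 2 ∧
    ((∑ i ∈ T, f i) ^ 2 ≤ ∑ i ∈ T, f i ^ 2 → T.Nonempty →
      ∃ i0 ∈ T, f i0 = ∑ i ∈ T, f i ∧ ∀ i ∈ T, i ≠ i0 → f i = 0) := by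
  set S := ∑ i ∈ T, f i with hS
  have hle : ∀ i ∈ T, f i ≤ S := fun i hi => Finset.single_le_sum (fun _ _ => Nat.zero_le _) hi
  have hle2 : ∀ i ∈ T, f i ^ 2 ≤ f i * S := fun i hi => by
    rw [sq]; exact Nat.mul_le_mul_left _ (hle i hi)
  have hSS : S ^ 2 = ∑ i ∈ T, f i * S := by rw [← Finset.sum_mul, sq]
  refine ⟨?_, ?_⟩
  · rw [hSS]; exact Finset.sum_le_sum hle2
  · intro hge hne
    have heq : ∑ i ∈ T, f i ^ 2 = ∑ i ∈ T, f i * S :=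
      le_antisymm (Finset.sum_le_sum hle2) (hSS ▸ hge)
    have hall := (Finset.sum_eq_sum_iff_of_le hle2).1 heq
    by_cases h0 : S = 0
    · obtain ⟨i0, hi0⟩ := hne
      refine ⟨i0, hi0, ?_, fun i hi _ => ?_⟩
      · have := hle i0 hi0; omega
      · have := hle i hi; omega
    · obtain ⟨i0, hi0, hne0⟩ : ∃ i0 ∈ T, f i0 ≠ 0 := by
        by_contra hcon
        push Not at hcon
        exact h0 (Finset.sum_eq_zero hcon)
      have h1 : f i0 = S := by
        have := hall i0 hi0
        rw [sq] at this
        exact Nat.eq_of_mul_eq_mul_left (Nat.pos_of_ne_zero hne0) this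
      refine ⟨i0, hi0, h1, fun i hi hii => ?_⟩
      have h2 : ∑ j ∈ T.erase i0, f j = 0 := by
        have := Finset.add_sum_erase T f hi0
        omega
      exact Finset.sum_eq_zero_iff.1 h2 i (Finset.mem_erase.2 ⟨hii, hi⟩)

open Classical in
/-- vertices of a component -/
noncomputable def cs {W : Type} [Fintype W] (F : SimpleGraph W) (c : F.ConnectedComponent) :
    Finset W := Finset.univ.filter fun v => F.connectedComponentMk v = c

theorem mem_cs {W : Type} [Fintype W] {F : SimpleGraph W} {c : F.ConnectedComponent} {v : W} :
    v ∈ cs F c ↔ F.connectedComponentMk v = c := by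
  simp [cs]

theorem adj_cs {W : Type} [Fintype W] {F : SimpleGraph W} {u v : W} (h : F.Adj u v) :
    F.connectedComponentMk u = F.connectedComponentMk v :=
  SimpleGraph.ConnectedComponent.sound h.reachable

open Classical in
theorem comp_deg {W : Type} [Fintype W] (F : SimpleGraph W) (c : F.ConnectedComponent) :
    2 * (cs F c).card ≤ ∑ v ∈ cs F c, F.degree v + 2 := by
  have hconn := c.connected_toSimpleGraph.card_vert_le_card_edgeSet_add_one
  have hsum := c.toSimpleGraph.sum_degrees_eq_twice_card_edges
  have hcard : Nat.card c = (cs F c).card := by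
    rw [Nat.card_eq_fintype_card, ← Fintype.card_coe]
    refine Fintype.card_congr (Equiv.subtypeEquivRight fun v => ?_)
    rw [mem_cs]; rfl
  have hE : Nat.card c.toSimpleGraph.edgeSet = c.toSimpleGraph.edgeFinset.card := by
    rw [Nat.card_eq_fintype_card, SimpleGraph.edgeFinset_card]
  have hdeg : ∀ x : c, c.toSimpleGraph.degree x = F.degree x.1 := by
    intro x
    rw [← SimpleGraph.card_neighborFinset_eq_degree, ← SimpleGraph.card_neighborFinset_eq_degree,
      ← Finset.card_map (Function.Embedding.subtype _)]
    congr 1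
    ext v
    simp only [Finset.mem_map, SimpleGraph.mem_neighborFinset]
    constructor
    · rintro ⟨y, hy, rfl⟩
      exact hy
    · intro h
      exact ⟨⟨v, c.mem_supp_of_adj_mem_supp x.2 h⟩, h, rfl⟩
  have h2 : ∑ x : c, c.toSimpleGraph.degree x = ∑ v ∈ cs F c, F.degree v := by
    simp_rw [hdeg]
    symm
    refine Finset.sum_subtype (cs F c) (p := fun v => v ∈ c) (fun v => ?_) (fun v => F.degree v)
    rw [mem_cs]; rfl
  rw [hcard, hE] at hconn
  have h3 : ∑ v ∈ cs F c, F.degree v = 2 * c.toSimpleGraph.edgeFinset.card := by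
    rw [← h2, ← hsum]
  omega

theorem comp_card {W : Type} [Fintype W] {s : ℕ} {F : SimpleGraph W} (hF : Expands s F)
    (c : F.ConnectedComponent) : s + 1 ≤ (cs F c).card := by
  by_contra hcon
  obtain ⟨v, hv⟩ := c.exists_rep
  obtain ⟨a, ha, b, hb, hab⟩ := hF (cs F c) ⟨v, mem_cs.2 hv⟩ (by omega)
  exact hb (mem_cs.2 ((adj_cs hab).symm.trans (mem_cs.1 ha)))

/-- `z` is the centre of the star component `c` -/
def IsCentre {W : Type} [Fintype W] (F : SimpleGraph W) (c : F.ConnectedComponent) (z : W) : Prop :=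
  z ∈ cs F c ∧ (∀ v ∈ cs F c, v ≠ z → F.Adj z v) ∧
    (∀ v ∈ cs F c, ∀ w ∈ cs F c, v ≠ z → w ≠ z → ¬ F.Adj v w)

open Classical in
theorem comp_sq {W : Type} [Fintype W] {s : ℕ} {F : SimpleGraph W} (hs : 2 ≤ s)
    (hF : Expands s F) (c : F.ConnectedComponent)
    (htree : ∑ v ∈ cs F c, F.degree v + 2 = 2 * (cs F c).card) :
    ∑ v ∈ cs F c, F.degree v ^ 2 + (cs F c).card ≤ (cs F c).card ^ 2 ∧
    ((cs F c).card ^ 2 ≤ ∑ v ∈ cs F c, F.degree v ^ 2 + (cs F c).card → ∃ z, IsCentre F c z) := by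
  have hm := comp_card hF c
  set m := (cs F c).card with hmdef
  have hpos : ∀ v, 1 ≤ F.degree v := by
    intro v
    obtain ⟨a, ha, b, hb, hab⟩ := hF {v} ⟨v, by simp⟩ (by simp; omega)
    rw [Finset.mem_singleton] at ha
    subst ha
    exact (F.degree_pos_iff_exists_adj a).2 ⟨b, hab⟩
  set f : W → ℕ := fun v => F.degree v - 1 with hf
  have hdf : ∀ v, F.degree v = f v + 1 := fun v => by
    have := hpos v
    simp only [hf]; omega
  have hsum : ∑ v ∈ cs F c, f v + m + 2 = 2 * m := by
    rw [← htree]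
    simp_rw [hdf, Finset.sum_add_distrib]
    simp [hmdef]
  have hsq : ∑ v ∈ cs F c, F.degree v ^ 2 =
      ∑ v ∈ cs F c, f v ^ 2 + 2 * ∑ v ∈ cs F c, f v + m := by
    simp_rw [hdf, add_sq, Finset.sum_add_distrib, one_pow, mul_one, ← Finset.mul_sum]
    simp [hmdef]
  obtain ⟨l1, l2⟩ := sq_lemma (cs F c) f
  set S := ∑ v ∈ cs F c, f v with hS
  have hmS : m = S + 2 := by omega
  have hm2 : m ^ 2 = S ^ 2 + 4 * S + 4 := by rw [hmS]; ring
  refine ⟨by omega, fun hge => ?_⟩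
  obtain ⟨z, hz, hzS, hz0⟩ := l2 (by omega) (Finset.card_pos.1 (by omega))
  have hzN : F.neighborFinset z = (cs F c).erase z := by
    apply Finset.eq_of_subset_of_card_le
    · intro v hv
      rw [SimpleGraph.mem_neighborFinset] at hv
      rw [Finset.mem_erase, mem_cs]
      exact ⟨hv.ne.symm, (adj_cs hv).symm.trans (mem_cs.1 hz)⟩
    · rw [Finset.card_erase_of_mem hz, SimpleGraph.card_neighborFinset_eq_degree, hdf z]
      omega
  have hzadj : ∀ v ∈ cs F c, v ≠ z → F.Adj z v := by
    intro v hv hvz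
    rw [← SimpleGraph.mem_neighborFinset, hzN, Finset.mem_erase]
    exact ⟨hvz, hv⟩
  refine ⟨z, hz, hzadj, ?_⟩
  intro v hv w hw hvz hwz hvw
  have h1 : F.degree v = 1 := by rw [hdf, hz0 v hv hvz]
  rw [← SimpleGraph.card_neighborFinset_eq_degree, Finset.card_eq_one] at h1
  obtain ⟨x, hx⟩ := h1
  have hw' : w ∈ F.neighborFinset v := by rwa [SimpleGraph.mem_neighborFinset]
  have hz' : z ∈ F.neighborFinset v := by
    rw [SimpleGraph.mem_neighborFinset]; exact (hzadj v hv hvz).symm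
  rw [hx, Finset.mem_singleton] at hw' hz'
  exact hwz (hw'.trans hz'.symm)

theorem sum_cs {W : Type} [Fintype W] (F : SimpleGraph W) [Fintype F.ConnectedComponent]
    (f : W → ℕ) : ∑ v, f v = ∑ c : F.ConnectedComponent, ∑ v ∈ cs F c, f v := by
  classical
  rw [← Finset.sum_fiberwise_of_maps_to (s := Finset.univ) (t := Finset.univ)
    (g := fun v => F.connectedComponentMk v) (fun _ _ => Finset.mem_univ _)]
  refine Finset.sum_congr rfl fun c _ => Finset.sum_congr ?_ fun _ _ => rfl
  ext v; simp [mem_cs]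

theorem forest {W : Type} [Fintype W] (F : SimpleGraph W) [Fintype F.ConnectedComponent]
    (s b A : ℕ) (hs : 2 ≤ s) (hb : 1 ≤ b)
    (hA : A < s + 1) (hW : Fintype.card W = b * (s + 1) + A) (hF : Expands s F) :
    2 * Fintype.card W ≤ w1 F + 2 * b ∧
    (w1 F + 2 * b = 2 * Fintype.card W → b * (s * (s + 1)) + (2 * s + 1) * A + A ^ 2 ≤ w2 F →
      Fintype.card F.ConnectedComponent = b ∧ (∀ c, ∃ z, IsCentre F c z) ∧
      ∃ c0, (cs F c0).card = s + 1 + A ∧ ∀ c, c ≠ c0 → (cs F c).card = s + 1) := by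
  classical
  set k := Fintype.card F.ConnectedComponent with hk
  have hcard : Fintype.card W = ∑ c : F.ConnectedComponent, (cs F c).card := by
    have := sum_cs F (fun _ => 1)
    simpa using this
  have hk1 : k * (s + 1) ≤ Fintype.card W := by
    rw [hcard]
    calc k * (s + 1) = ∑ c : F.ConnectedComponent, (s + 1) := by simp [hk]
      _ ≤ _ := Finset.sum_le_sum fun c _ => comp_card hF c
  have hkb : k ≤ b := by
    by_contra hcon
    have h1 : (b + 1) * (s + 1) ≤ k * (s + 1) := Nat.mul_le_mul_right _ (by omega)
    have h2 : (b + 1) * (s + 1) = b * (s + 1) + (s + 1) := by ring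
    omega
  have hw1 : w1 F = ∑ c : F.ConnectedComponent, ∑ v ∈ cs F c, F.degree v := by
    rw [w1, ← sum_cs]
  have hw2 : w2 F = ∑ c : F.ConnectedComponent, ∑ v ∈ cs F c, F.degree v ^ 2 := by
    rw [w2, ← sum_cs]
  have h2c : ∑ c : F.ConnectedComponent, 2 * (cs F c).card = 2 * Fintype.card W := by
    rw [hcard, Finset.mul_sum]
  have h2k : ∑ c : F.ConnectedComponent, (∑ v ∈ cs F c, F.degree v + 2) = w1 F + 2 * k := by
    rw [Finset.sum_add_distrib, hw1]; simp [hk, mul_comm]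
  have hle : 2 * Fintype.card W ≤ w1 F + 2 * k := by
    rw [← h2c, ← h2k]
    exact Finset.sum_le_sum fun c _ => comp_deg F c
  refine ⟨by omega, fun heq hge => ?_⟩
  have hkb' : k = b := by omega
  have htree : ∀ c : F.ConnectedComponent,
      ∑ v ∈ cs F c, F.degree v + 2 = 2 * (cs F c).card := by
    have h1 : ∑ c : F.ConnectedComponent, 2 * (cs F c).card =
        ∑ c : F.ConnectedComponent, (∑ v ∈ cs F c, F.degree v + 2) := by
      rw [h2c, h2k]; omega
    have := (Finset.sum_eq_sum_iff_of_le (fun c _ => comp_deg F c)).1 h1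
    exact fun c => (this c (Finset.mem_univ c)).symm
  set a : F.ConnectedComponent → ℕ := fun c => (cs F c).card - (s + 1) with ha
  have hma : ∀ c, (cs F c).card = s + 1 + a c := by
    intro c
    have := comp_card hF c
    simp only [ha]; omega
  have hsa : ∑ c, a c = A := by
    have h1 : Fintype.card W = k * (s + 1) + ∑ c, a c := by
      rw [hcard]
      simp_rw [hma, Finset.sum_add_distrib]
      simp [hk, mul_add]
    rw [hkb'] at h1
    omega
  obtain ⟨l1, l2⟩ := sq_lemma Finset.univ a
  rw [hsa] at l1 l2
  have hm2 : ∑ c : F.ConnectedComponent, (cs F c).card ^ 2 =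
      b * (s + 1) ^ 2 + 2 * (s + 1) * A + ∑ c, a c ^ 2 := by
    simp_rw [hma, add_sq, Finset.sum_add_distrib, ← Finset.mul_sum]
    rw [hsa]
    simp [← hk, hkb', mul_add]
    ring
  have hsq : ∀ c : F.ConnectedComponent, c ∈ Finset.univ →
      ∑ v ∈ cs F c, F.degree v ^ 2 + (cs F c).card ≤ (cs F c).card ^ 2 :=
    fun c _ => (comp_sq hs hF c (htree c)).1
  have hsqs : ∑ c : F.ConnectedComponent, (∑ v ∈ cs F c, F.degree v ^ 2 + (cs F c).card) =
      w2 F + Fintype.card W := by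
    rw [Finset.sum_add_distrib, ← hw2, hcard]
  have hsl := Finset.sum_le_sum hsq
  rw [hsqs, hm2, hW] at hsl
  have hid : b * (s * (s + 1)) + (2 * s + 1) * A + A ^ 2 + (b * (s + 1) + A) =
      b * (s + 1) ^ 2 + 2 * (s + 1) * A + A ^ 2 := by ring
  have hA2 : ∑ c, a c ^ 2 = A ^ 2 := by omega
  have hNe : (Finset.univ : Finset F.ConnectedComponent).Nonempty := by
    rw [← Finset.card_pos, Finset.card_univ, ← hk]; omega
  obtain ⟨c0, _, hc0, hc1⟩ := l2 hA2.ge hNe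
  refine ⟨hkb', fun c => ?_, c0, ?_, ?_⟩
  · have h1 : ∑ c : F.ConnectedComponent, (∑ v ∈ cs F c, F.degree v ^ 2 + (cs F c).card) =
        ∑ c : F.ConnectedComponent, (cs F c).card ^ 2 := by
      rw [hsqs, hm2, hW]; omega
    have h2 := (Finset.sum_eq_sum_iff_of_le hsq).1 h1 c (Finset.mem_univ c)
    exact (comp_sq hs hF c (htree c)).2 h2.ge
  · rw [hma, hc0]
  · intro c hc
    rw [hma, hc1 c (Finset.mem_univ c) hc]

end CTP
namespace CTP

theorem hst_ll (s t : ℕ) (i j) (p q) : (Hst s t).Adj (Sum.inl (i, p)) (Sum.inl (j, q)) ↔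
    i = j ∧ (starG s).Adj p q := by
  simp only [Hst, gUnion, copies, SimpleGraph.fromRel_adj]
  constructor
  · rintro ⟨_, (⟨a, b, ha, hb, h⟩ | ⟨a, b, ha, hb, h⟩) | (⟨a, b, ha, hb, h⟩ | ⟨a, b, ha, hb, h⟩)⟩
    · cases ha; cases hb
      rcases h with ⟨_, h | h⟩
      · exact h
      · exact ⟨h.1.symm, h.2.symm⟩
    · cases ha
    · cases ha; cases hb
      rcases h with ⟨_, h | h⟩
      · exact ⟨h.1.symm, h.2.symm⟩
      · exact h
    · cases ha
  · rintro ⟨rfl, h⟩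
    have hne := h.ne
    refine ⟨by simpa using hne, Or.inl (Or.inl ⟨_, _, rfl, rfl, by simpa using hne, Or.inl ⟨rfl, h⟩⟩)⟩

theorem hst_rr (s t : ℕ) (p q) : (Hst s t).Adj (Sum.inr p) (Sum.inr q) ↔
    (starG _).Adj p q := by
  simp only [Hst, gUnion, copies, SimpleGraph.fromRel_adj]
  constructor
  · rintro ⟨_, (⟨a, b, ha, hb, h⟩ | ⟨a, b, ha, hb, h⟩) | (⟨a, b, ha, hb, h⟩ | ⟨a, b, ha, hb, h⟩)⟩
    · cases ha
    · cases ha; cases hb; exact h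
    · cases ha
    · cases ha; cases hb; exact h.symm
  · intro h
    have hne := h.ne
    refine ⟨by simpa using hne, Or.inl (Or.inr ⟨_, _, rfl, rfl, h⟩)⟩

theorem hst_lr (s t : ℕ) (x) (q) : ¬ (Hst s t).Adj (Sum.inl x) (Sum.inr q) := by
  simp only [Hst, gUnion, copies, SimpleGraph.fromRel_adj]
  rintro ⟨_, (⟨a, b, ha, hb, h⟩ | ⟨a, b, ha, hb, h⟩) | (⟨a, b, ha, hb, h⟩ | ⟨a, b, ha, hb, h⟩)⟩
  · cases hb
  · cases ha
  · cases ha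
  · cases hb

theorem hst_rl (s t : ℕ) (x) (q) : ¬ (Hst s t).Adj (Sum.inr q) (Sum.inl x) :=
  fun h => hst_lr s t x q h.symm

theorem star_expands {X : Type} (m s : ℕ) (hms : s ≤ m) (F : SimpleGraph X)
    (f : Fin 1 ⊕ Fin m → X) (hf : Function.Injective f)
    (hadj : ∀ p q, (starG m).Adj p q → F.Adj (f p) (f q)) (A : Finset X) (hA : A.card ≤ s)
    (p : Fin 1 ⊕ Fin m) (hp : f p ∈ A) : ∃ a ∈ A, ∃ b, b ∉ A ∧ F.Adj a b := by
  classical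
  by_cases hz : f (Sum.inl 0) ∈ A
  · obtain ⟨j, hj⟩ : ∃ j : Fin m, f (Sum.inr j) ∉ A := by
      by_contra hcon
      push Not at hcon
      have : Finset.univ.image f ⊆ A := by
        intro x hx
        obtain ⟨q, _, rfl⟩ := Finset.mem_image.1 hx
        rcases q with q | q
        · rw [Subsingleton.elim q 0]; exact hz
        · exact hcon q
      have := Finset.card_le_card this
      rw [Finset.card_image_of_injective _ hf] at this
      simp at this
      omega
    exact ⟨_, hz, _, hj, hadj _ _ (by simp [starG])⟩
  · rcases p with p | p
    · rw [Subsingleton.elim p 0] at hp; exact absurd hp hz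
    · exact ⟨_, hp, _, hz, hadj _ _ (by simp [starG])⟩

theorem hst_expands (s t : ℕ) (h : s ≤ t - ((t+1)/(s+1) - 1) * (s+1)) : Expands s (Hst s t) := by
  intro A hA hAs
  obtain ⟨x, hx⟩ := hA
  rcases x with ⟨i, p⟩ | p
  · refine star_expands s s le_rfl (Hst s t) (fun q => Sum.inl (i, q)) ?_ ?_ A hAs p hx
    · intro a b hab; simpa using hab
    · intro a b hab; exact (hst_ll _ _ _ _ _ _).2 ⟨rfl, hab⟩
  · refine star_expands _ s h (Hst s t) (fun q => Sum.inr q) ?_ ?_ A hAs p hx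
    · intro a b hab; simpa using hab
    · intro a b hab; exact (hst_rr _ _ _ _).2 hab

open Classical in
theorem degree_sum {X : Type} [Fintype X] (F : SimpleGraph X) (v : X) :
    F.degree v = ∑ u, if F.Adj v u then 1 else 0 := by
  rw [Finset.sum_boole, ← SimpleGraph.card_neighborFinset_eq_degree]
  simp only [Nat.cast_id]
  congr 1
  ext u; simp

open Classical in
theorem hst_deg_l (s t : ℕ) (i) (p) : (Hst s t).degree (Sum.inl (i, p)) =
    Sum.elim (fun _ => s) (fun _ => 1) p := by
  rw [degree_sum, Fintype.sum_sum_type, Fintype.sum_prod_type]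
  simp only [hst_ll, hst_lr, if_false, Finset.sum_const_zero, add_zero]
  rw [Finset.sum_eq_single i]
  · rw [Fintype.sum_sum_type]
    rcases p with p | p <;> simp [starG]
  · intro j _ hj
    simp [Ne.symm hj]
  · simp

open Classical in
theorem hst_deg_r (s t : ℕ) (p) : (Hst s t).degree (Sum.inr p) =
    Sum.elim (fun _ => t - ((t+1)/(s+1) - 1) * (s+1)) (fun _ => 1) p := by
  rw [degree_sum, Fintype.sum_sum_type]
  simp only [hst_rr, hst_rl, if_false, Finset.sum_const_zero, zero_add]
  rw [Fintype.sum_sum_type]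
  rcases p with p | p <;> simp [starG]

theorem hst_w1 (s t b α : ℕ) (hb : (t+1)/(s+1) - 1 = b)
    (hα : t - ((t+1)/(s+1) - 1) * (s+1) = α) : w1 (Hst s t) = b * (2 * s) + 2 * α := by
  classical
  rw [w1, Fintype.sum_sum_type, Fintype.sum_prod_type]
  simp only [Fintype.sum_sum_type, hst_deg_l, hst_deg_r, Sum.elim_inl, Sum.elim_inr]
  simp only [Finset.sum_const, Finset.card_univ, Fintype.card_fin, smul_eq_mul]
  rw [hα, hb]
  ring

theorem hst_w2 (s t b α : ℕ) (hb : (t+1)/(s+1) - 1 = b)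
    (hα : t - ((t+1)/(s+1) - 1) * (s+1) = α) :
    w2 (Hst s t) = b * (s ^ 2 + s) + α ^ 2 + α := by
  classical
  rw [w2, Fintype.sum_sum_type, Fintype.sum_prod_type]
  simp only [Fintype.sum_sum_type, hst_deg_l, hst_deg_r, Sum.elim_inl, Sum.elim_inr]
  simp only [Finset.sum_const, Finset.card_univ, Fintype.card_fin, smul_eq_mul]
  rw [hα, hb]
  ring

theorem w1_iso {X Y : Type} [Fintype X] [Fintype Y] {F : SimpleGraph X} {F' : SimpleGraph Y}
    (e : F ≃g F') : w1 F = w1 F' := by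
  classical
  unfold w1
  rw [← e.toEquiv.sum_comp]
  exact Finset.sum_congr rfl fun v _ => (e.degree_eq v).symm

theorem w2_iso {X Y : Type} [Fintype X] [Fintype Y] {F : SimpleGraph X} {F' : SimpleGraph Y}
    (e : F ≃g F') : w2 F = w2 F' := by
  classical
  unfold w2
  rw [← e.toEquiv.sum_comp]
  exact Finset.sum_congr rfl fun v _ => congrArg (· ^ 2) (e.degree_eq v).symm

theorem expands_iso {X Y : Type} {s : ℕ} {F : SimpleGraph X} {F' : SimpleGraph Y}
    (e : F ≃g F') (h : Expands s F') : Expands s F := by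
  classical
  intro A hA hAs
  obtain ⟨a, ha, b, hb, hab⟩ := h (A.map e.toEquiv.toEmbedding) (hA.map) (by simpa using hAs)
  obtain ⟨a', ha', rfl⟩ := Finset.mem_map.1 ha
  refine ⟨a', ha', e.symm b, fun h => hb (Finset.mem_map.2 ⟨_, h, e.apply_symm_apply b⟩), ?_⟩
  rw [← e.map_adj_iff, e.apply_symm_apply]
  exact hab

theorem deg_compl {X : Type} [Fintype X] (t : ℕ) (hX : Fintype.card X = t + 1)
    (F : SimpleGraph X) (v : X) {i1 : Fintype (Fᶜ.neighborSet v)} {i2 : Fintype (F.neighborSet v)} :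
    Fᶜ.degree v + F.degree v = t := by
  have h1 : Fᶜ.degree v = Fintype.card X - 1 - F.degree v := by
    classical
    convert SimpleGraph.degree_compl F v
  have h2 : F.degree v < Fintype.card X := by
    classical
    convert F.degree_lt_card_verts v
  omega

theorem w1_compl {X : Type} [Fintype X] (t : ℕ) (hX : Fintype.card X = t + 1)
    (F : SimpleGraph X) : w1 Fᶜ + w1 F = (t + 1) * t := by
  classical
  unfold w1
  rw [← Finset.sum_add_distrib]
  refine Eq.trans (b := ∑ _v : X, t) (Finset.sum_congr rfl fun v _ => ?_) ?_
  · exact deg_compl t hX F v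
  simp [hX]

theorem w2_compl {X : Type} [Fintype X] (t : ℕ) (hX : Fintype.card X = t + 1)
    (F : SimpleGraph X) : w2 Fᶜ + 2 * t * w1 F = (t + 1) * t ^ 2 + w2 F := by
  classical
  have key : ∀ a b : ℕ, a + b = t → a ^ 2 + 2 * t * b = t ^ 2 + b ^ 2 := by
    rintro a b rfl; ring
  unfold w1 w2
  rw [Finset.mul_sum, ← Finset.sum_add_distrib]
  have hc : (t + 1) * t ^ 2 = ∑ _v : X, t ^ 2 := by simp [hX]
  rw [hc, ← Finset.sum_add_distrib]
  refine Finset.sum_congr rfl fun v _ => ?_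
  exact key _ _ (deg_compl t hX F v)

theorem star_embed {W : Type} [Fintype W] (F : SimpleGraph W) (c : F.ConnectedComponent) (z : W)
    (hz : IsCentre F c z) (m : ℕ) (hm : (cs F c).card = m + 1) :
    ∃ f : Fin 1 ⊕ Fin m → W, Function.Injective f ∧ (∀ p, F.connectedComponentMk (f p) = c) ∧
      ∀ p q, F.Adj (f p) (f q) ↔ (starG m).Adj p q := by
  classical
  have hc : ((cs F c).erase z).card = m := by
    rw [Finset.card_erase_of_mem hz.1]; omega
  let e := ((cs F c).erase z).equivFinOfCardEq hc
  have h1 : ∀ j, (e.symm j : W) ∈ cs F c := fun j => Finset.mem_of_mem_erase (e.symm j).2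
  have h2 : ∀ j, (e.symm j : W) ≠ z := fun j => Finset.ne_of_mem_erase (e.symm j).2
  refine ⟨Sum.elim (fun _ => z) (fun j => (e.symm j : W)), ?_, ?_, ?_⟩
  · rintro (p | p) (q | q) h
    · rw [Subsingleton.elim p q]
    · exact absurd h.symm (h2 q)
    · exact absurd h (h2 p)
    · have : e.symm p = e.symm q := Subtype.ext h
      rw [e.symm.injective this]
  · rintro (p | p)
    · exact mem_cs.1 hz.1
    · exact mem_cs.1 (h1 p)
  · rintro (p | p) (q | q)
    · simp [starG]
    · simpa [starG] using hz.2.1 _ (h1 q) (h2 q)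
    · simpa [starG] using (hz.2.1 _ (h1 p) (h2 p)).symm
    · simpa [starG] using hz.2.2 _ (h1 p) _ (h1 q) (h2 p) (h2 q)

theorem build_iso {W : Type} [Fintype W] (F : SimpleGraph W) [Fintype F.ConnectedComponent]
    (s t : ℕ) (hcomp : Fintype.card F.ConnectedComponent = (t+1)/(s+1) - 1 + 1)
    (hW : Fintype.card W = ((t+1)/(s+1) - 1) * (s+1) + (1 + (t - ((t+1)/(s+1) - 1) * (s+1))))
    (hz : ∀ c, ∃ z, IsCentre F c z) (c0 : F.ConnectedComponent)
    (hc0 : (cs F c0).card = (t - ((t+1)/(s+1) - 1) * (s+1)) + 1)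
    (hc : ∀ c, c ≠ c0 → (cs F c).card = s + 1) : Nonempty (Hst s t ≃g F) := by
  classical
  have hcc : Fintype.card {c // c ≠ c0} = (t+1)/(s+1) - 1 := by
    rw [Fintype.card_subtype_compl, hcomp]; simp
  let e := (Fintype.equivFinOfCardEq hcc).symm
  obtain ⟨z0, hz0⟩ := hz c0
  obtain ⟨f0, hf0, hf0c, hf0a⟩ := star_embed F c0 z0 hz0 _ hc0
  have : ∀ i, ∃ f : Fin 1 ⊕ Fin s → W, Function.Injective f ∧
      (∀ p, F.connectedComponentMk (f p) = (e i).1) ∧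
      ∀ p q, F.Adj (f p) (f q) ↔ (starG s).Adj p q := by
    intro i
    obtain ⟨z, hz⟩ := hz (e i).1
    exact star_embed F _ z hz s (hc _ (e i).2)
  choose f hf hfc hfa using this
  let Φ : ((Fin ((t+1)/(s+1) - 1) × (Fin 1 ⊕ Fin s)) ⊕
      (Fin 1 ⊕ Fin (t - ((t+1)/(s+1) - 1) * (s+1)))) → W :=
    Sum.elim (fun x => f x.1 x.2) f0
  have hne : ∀ i p q, F.connectedComponentMk (f i p) ≠ F.connectedComponentMk (f0 q) := by
    intro i p q h
    rw [hfc, hf0c] at h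
    exact (e i).2 h
  have hii : ∀ i j p q, F.connectedComponentMk (f i p) = F.connectedComponentMk (f j q) → i = j := by
    intro i j p q h
    rw [hfc, hfc] at h
    exact e.injective (Subtype.ext h)
  have hinj : Function.Injective Φ := by
    rintro (⟨i, p⟩ | p) (⟨j, q⟩ | q) h
    · have h' : f i p = f j q := h
      have hij := hii i j p q (by rw [h'])
      subst hij
      rw [hf i h']
    · have h' : f i p = f0 q := h
      exact absurd (by rw [h']) (hne i p q)
    · have h' : f0 p = f j q := h
      exact absurd (by rw [h']) (hne j q p)
    · rw [hf0 h]
  have hbij : Function.Bijective Φ := by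
    rw [Fintype.bijective_iff_injective_and_card]
    refine ⟨hinj, ?_⟩
    rw [hW]
    simp only [Fintype.card_sum, Fintype.card_prod, Fintype.card_fin]
    ring
  refine ⟨⟨Equiv.ofBijective Φ hbij, ?_⟩⟩
  rintro (⟨i, p⟩ | p) (⟨j, q⟩ | q)
  · change F.Adj (f i p) (f j q) ↔ _
    rw [hst_ll]
    constructor
    · intro h
      have hij := hii i j p q (adj_cs h)
      subst hij
      exact ⟨rfl, (hfa _ _ _).1 h⟩
    · rintro ⟨rfl, h⟩
      exact (hfa _ _ _).2 h
  · change F.Adj (f i p) (f0 q) ↔ _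
    exact ⟨fun h => absurd (adj_cs h) (hne i p q), fun h => absurd h (hst_lr _ _ _ _)⟩
  · change F.Adj (f0 p) (f j q) ↔ _
    exact ⟨fun h => absurd (adj_cs h).symm (hne j q p), fun h => absurd h (hst_rl _ _ _ _)⟩
  · change F.Adj (f0 p) (f0 q) ↔ _
    rw [hst_rr]
    exact hf0a p q

end CTP
namespace CTP

theorem final_arith (t s b A α : ℕ) (hα : α = A + s) (hb : 1 ≤ b)
    (hW : t + 1 = b * (s + 1) + A) :
    ((b - 1) * (2 * s) + 2 * α) + 2 * b = 2 * (t + 1) ∧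
    (b - 1) * (s ^ 2 + s) + α ^ 2 + α = b * (s * (s + 1)) + (2 * s + 1) * A + A ^ 2 := by
  obtain ⟨c, rfl⟩ : ∃ c, b = c + 1 := ⟨b - 1, by omega⟩
  subst hα
  rw [hW]
  simp only [Nat.add_sub_cancel]
  constructor <;> ring

theorem w1_edges {X : Type} [Fintype X] (F : SimpleGraph X) : w1 F = 2 * ecard F := by
  classical
  have h := F.sum_degrees_eq_twice_card_edges
  have h2 : ecard F = F.edgeFinset.card := by
    rw [ecard, Set.ncard_eq_toFinset_card']
    rfl
  rw [h2, ← h]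
  unfold w1
  refine Finset.sum_congr rfl fun v _ => ?_
  convert rfl

theorem core {V W : Type} [Fintype V] [DecidableEq V] [Fintype W] {s t : ℕ}
    {G : SimpleGraph V} {K : Finset V} {ι : W ↪ V} (S : Setup s t G K ι) (ht : 4 ≤ t)
    (hn : (t + (t+1)*t^3 + (t+1)*t^2 + 2)^2 + s ≤ Fintype.card V)
    (hG : ¬ MinorOf (completeBipartiteGraph (Fin s) (Fin t)) G)
    (hext : ∀ G' : SimpleGraph V,
        ¬ MinorOf (completeBipartiteGraph (Fin s) (Fin t)) G' → specRad G' ≤ specRad G)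
    (hconn : (G.comap ι).Connected) :
    2 ≤ (t+1)/(s+1) ∧ Nonempty (G.comap ι ≃g (Hst s t)ᶜ) ∧
      ecard (G.comap ι) = t.choose 2 + ((t+1)/(s+1) - 1) := by
  classical
  have hs := S.hs
  have hst := S.hst
  have hcW := S.cardW
  obtain ⟨b, hbdef⟩ : ∃ b, b = (t+1)/(s+1) := ⟨_, rfl⟩
  have hb1 : 1 ≤ b := by
    rw [hbdef]; exact Nat.div_pos (by omega) (by omega)
  obtain ⟨A, hAdef⟩ : ∃ A, A = (t+1) % (s+1) := ⟨_, rfl⟩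
  have hA : A < s + 1 := by rw [hAdef]; exact Nat.mod_lt _ (by omega)
  have hW : t + 1 = b * (s + 1) + A := by
    rw [hbdef, hAdef, mul_comm]; exact (Nat.div_add_mod _ _).symm
  obtain ⟨α, hαdef⟩ : ∃ α, t - ((t+1)/(s+1) - 1) * (s+1) = α := ⟨_, rfl⟩
  have hsum : t = (b - 1) * (s + 1) + (A + s) := by
    obtain ⟨c, rfl⟩ : ∃ c, b = c + 1 := ⟨b - 1, by omega⟩
    simp only [Nat.add_sub_cancel]
    have : (c + 1) * (s + 1) = c * (s + 1) + (s + 1) := by ring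
    omega
  have hα : α = A + s := by
    rw [← hαdef, ← hbdef]; omega
  obtain ⟨ar1, ar2⟩ := final_arith t s b A α hα hb1 hW
  have hcard : Fintype.card W = Fintype.card ((Fin ((t+1)/(s+1) - 1) × (Fin 1 ⊕ Fin s)) ⊕
      (Fin 1 ⊕ Fin (t - ((t+1)/(s+1) - 1) * (s+1)))) := by
    rw [hcW]
    simp only [Fintype.card_sum, Fintype.card_prod, Fintype.card_fin]
    rw [hαdef, ← hbdef, hα, add_comm 1 s]
    omega
  let e := Fintype.equivOfCardEq hcard
  let F' : SimpleGraph W := (Hst s t).comap e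
  have ei : F' ≃g Hst s t := SimpleGraph.Iso.comap e (Hst s t)
  have hF'w1 : w1 F' = (b - 1) * (2 * s) + 2 * α := by
    rw [w1_iso ei]; exact hst_w1 s t (b - 1) α (by rw [hbdef]) hαdef
  have hF'w2 : w2 F' = (b - 1) * (s ^ 2 + s) + α ^ 2 + α := by
    rw [w2_iso ei]; exact hst_w2 s t (b - 1) α (by rw [hbdef]) hαdef
  have hexp' : Expands s F' := expands_iso ei (hst_expands s t (by rw [hαdef, hα]; omega))
  have hsp := spec_cmp S F'ᶜ hn (hext _ (repl_minorFree S hG F'ᶜ (by rw [compl_compl]; exact hexp')))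
  have hexp := expands_of_minorFree S hG
  obtain ⟨F, hF⟩ : ∃ F, F = (G.comap ι)ᶜ := ⟨_, rfl⟩
  have hFc : G.comap ι = Fᶜ := by rw [hF, compl_compl]
  rw [← hF] at hexp
  rw [hFc] at hsp hconn ⊢
  letI : Fintype F.ConnectedComponent := Fintype.ofFinite _
  obtain ⟨f1, f2⟩ := forest F s b A hs hb1 hA (by rw [hcW, hW]) hexp
  have c1 := w1_compl t hcW F
  have c2 := w2_compl t hcW F
  have d1 := w1_compl t hcW F'
  have d2 := w2_compl t hcW F'
  rw [hcW] at f1 f2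
  push Not at hsp
  have heq : w1 F = w1 F' := by omega
  rw [heq] at c2
  have hw2 := hsp.2 (by omega)
  obtain ⟨g1, g2, c0, g3, g4⟩ := f2 (by omega) (by omega)
  obtain ⟨iso⟩ := build_iso F s t (by rw [g1, ← hbdef]; omega)
    (by rw [hcW, hαdef, ← hbdef, hα]; omega) g2 c0 (by rw [g3, hαdef, hα]; omega) g4
  have hiso : Fᶜ ≃g (Hst s t)ᶜ :=
    ⟨iso.symm.toEquiv, by
      intro u v
      simp only [SimpleGraph.compl_adj]
      have h1 : (Hst s t).Adj (iso.symm.toEquiv u) (iso.symm.toEquiv v) ↔ F.Adj u v :=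
        iso.symm.map_adj_iff
      rw [h1, iso.symm.toEquiv.injective.ne_iff]⟩
  refine ⟨?_, ⟨hiso⟩, ?_⟩
  · by_contra hlt
    have hb0 : (t+1)/(s+1) - 1 = 0 := by omega
    have hnt : Nontrivial W := Fintype.one_lt_card_iff_nontrivial.1 (by omega)
    obtain ⟨v, hv⟩ := hconn.preconnected.exists_adj_of_nontrivial
      (hiso.symm (Sum.inr (Sum.inl 0)))
    rw [← hiso.map_adj_iff, RelIso.apply_symm_apply, SimpleGraph.compl_adj] at hv
    rcases h : hiso v with ⟨i, p⟩ | p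
    · have := i.2; omega
    · rw [h] at hv
      rcases p with p | p
      · exact hv.1 (by rw [Subsingleton.elim p 0])
      · exact hv.2 ((hst_rr _ _ _ _).2 (by simp [starG]))
  · rw [← hbdef]
    have e1 := w1_edges Fᶜ
    have e2 : t.choose 2 * 2 = t * (t - 1) := by
      rw [Nat.choose_two_right]; exact Nat.div_mul_cancel (Nat.even_mul_pred_self t).two_dvd
    have e3 : t * (t - 1) + t = t * t := by
      obtain ⟨c, rfl⟩ : ∃ c, t = c + 1 := ⟨t - 1, by omega⟩
      simp only [Nat.add_sub_cancel]; ring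
    have e4 : (t + 1) * t = t * t + t := by ring
    omega

end CTP

/-- Theorem 3.1: (t+1)-vertex components of G⋆ − K. -/
theorem component_t_plus_one (s t : ℕ) (ht : 4 ≤ t) (hs : 2 ≤ s) (hst : s ≤ t) :
    ∃ n₀ : ℕ, ∀ n : ℕ, n₀ ≤ n →
    ∀ (G : SimpleGraph (Fin n)) (K : Finset (Fin n)),
      ¬ MinorOf (completeBipartiteGraph (Fin s) (Fin t)) G →
      (∀ G' : SimpleGraph (Fin n),
        ¬ MinorOf (completeBipartiteGraph (Fin s) (Fin t)) G' → specRad G' ≤ specRad G) →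
      K.card = s - 1 → G.IsClique (↑K : Set (Fin n)) →
      (∀ v : Fin n, v ∉ K → ∀ u ∈ K, G.Adj u v) →
      ∀ c : (G.comap (Subtype.val : {v : Fin n // v ∉ K} → Fin n)).ConnectedComponent,
        c.supp.ncard = t + 1 →
        2 ≤ (t+1)/(s+1) ∧
        Nonempty ((G.comap (Subtype.val : {v : Fin n // v ∉ K} → Fin n)).induce c.supp ≃g (Hst s t)ᶜ) ∧
        ecard ((G.comap (Subtype.val : {v : Fin n // v ∉ K} → Fin n)).induce c.supp) =
          t.choose 2 + ((t+1)/(s+1) - 1) := by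
  classical
  refine ⟨(t + (t+1)*t^3 + (t+1)*t^2 + 2)^2 + s, ?_⟩
  intro n hn G K hG hext hK hcl hdom c hc
  letI : Fintype c.supp := Fintype.ofFinite _
  let ι : c.supp ↪ Fin n := ⟨fun w => w.1.1, fun a b h => Subtype.ext (Subtype.ext h)⟩
  have S : CTP.Setup s t G K ι :=
    { hs := hs
      hst := hst
      cardK := hK
      clique := hcl
      dom := hdom
      notK := fun w => w.1.2
      closed := by
        intro w v hv hadj
        refine ⟨⟨⟨v, hv⟩, ?_⟩, rfl⟩
        exact SimpleGraph.ConnectedComponent.mem_supp_of_adj_mem_supp c w.2 hadj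
      cardW := by
        rw [← hc, Set.ncard_eq_toFinset_card', Set.toFinset_card] }
  have hconn : (G.comap ι).Connected := c.connected_toSimpleGraph
  have r := CTP.core S ht (by simpa using hn) hG hext hconn
  exact r
end

section
/- Let t ≥ 4 and 2 ≤ s ≤ t with β = ⌊(t+1)/(s+1)⌋ ≤ 2, and let G be a connected graph on t+2 vertices having the (s,t)-property. Then e(G) ≤ C(t,2) + 2; and if e(G) = C(t,2) + 2, then the complement \overline{G} is isomorphic either to H_{a,b,c} for some nonnegative integers a, b, c with a + b + c = t − 1, or to the Petersen graph. -/
open SimpleGraph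

lemma minor_transfer {α β α' β' V : Type} (e : α' ≃ α) (f : β' ≃ β) {G : SimpleGraph V}
    (h : MinorOf (completeBipartiteGraph α β) G) :
    MinorOf (completeBipartiteGraph α' β') G := by
  obtain ⟨φ, h1, h2, h3⟩ := h
  refine ⟨fun x => φ (Sum.map e f x), fun a => h1 _, fun a b hab => h2 ?_, fun a b hab => h3 _ _ ?_⟩
  · intro hh
    apply hab
    exact (Function.Injective.sumMap e.injective f.injective) hh
  · rcases a with a | a <;> rcases b with b | b <;> simp_all

lemma minor_swap {α β V : Type} {G : SimpleGraph V}
    (h : MinorOf (completeBipartiteGraph α β) G) :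
    MinorOf (completeBipartiteGraph β α) G := by
  obtain ⟨φ, h1, h2, h3⟩ := h
  refine ⟨fun x => φ x.swap, fun a => h1 _, fun a b hab => h2 ?_, fun a b hab => h3 _ _ ?_⟩
  · intro hh
    apply hab
    simpa using congrArg Sum.swap hh
  · rcases a with a | a <;> rcases b with b | b <;> simp_all

lemma conn_single {V : Type} (G : SimpleGraph V) (x : V) : (G.induce {x}).Connected := by
  haveI : Unique ({x} : Set V) := Set.uniqueSingleton x
  exact ⟨SimpleGraph.Preconnected.of_subsingleton⟩

lemma conn_pair {V : Type} (G : SimpleGraph V) {x y : V} (h : G.Adj x y) :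
    (G.induce {x, y}).Connected := by
  exact SimpleGraph.induce_pair_connected_of_adj h

open Classical in
lemma minor_key {s t : ℕ} {V : Type} [Fintype V] (hV : Fintype.card V = t + 2)
    {G : SimpleGraph V} (hprop : HasSTProp s t G) {u v : V} (huv : G.Adj u v)
    (T : Finset V) (huT : u ∉ T) (hvT : v ∉ T)
    (hTS : ∀ x ∈ T, ∀ y, y ∉ T → y ≠ u → y ≠ v → G.Adj x y)
    (hX : ∀ y, y ∉ T → y ≠ u → y ≠ v → G.Adj u y ∨ G.Adj v y)
    (hne : ∃ y, y ∉ T ∧ y ≠ u ∧ y ≠ v) : s ≤ T.card := by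
  by_contra hlt
  push Not at hlt
  set S : Finset V := Finset.univ \ (insert u (insert v T)) with hS
  have hmem : ∀ y, y ∈ S ↔ (y ∉ T ∧ y ≠ u ∧ y ≠ v) := by
    intro y; simp [hS]; tauto
  have hcard : S.card + (T.card + 1) = t + 1 := by
    have h1 : (insert u (insert v T)).card = T.card + 2 := by
      rw [Finset.card_insert_of_notMem, Finset.card_insert_of_notMem hvT]
      simp [huT, huv.ne]
    have h2 := Finset.card_sdiff_add_card_eq_card (Finset.subset_univ (insert u (insert v T)))
    rw [← hS, h1, Finset.card_univ, hV] at h2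
    omega
  have hSpos : 1 ≤ S.card := by
    obtain ⟨y, hy⟩ := hne
    exact Finset.card_pos.mpr ⟨y, (hmem y).2 hy⟩
  have hminor : MinorOf (completeBipartiteGraph S (Option T)) G := by
    refine ⟨fun x => match x with
      | Sum.inl y => {y.1}
      | Sum.inr none => {u, v}
      | Sum.inr (some y) => {y.1}, ?_, ?_, ?_⟩
    · rintro (y | _ | y)
      · exact conn_single G _
      · exact conn_pair G huv
      · exact conn_single G _
    · rintro (⟨y, hy⟩ | _ | ⟨y, hy⟩) (⟨z, hz⟩ | _ | ⟨z, hz⟩) hyz <;>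
        simp only [Set.disjoint_left, Set.mem_singleton_iff, Set.mem_insert_iff] <;>
        simp only [hmem] at * <;> rintro x hx <;> simp_all <;> grind
    · rintro (⟨y, hy⟩ | _ | ⟨y, hy⟩) (⟨z, hz⟩ | _ | ⟨z, hz⟩) hyz <;>
        simp only [hmem] at * <;> simp_all <;> grind [SimpleGraph.adj_comm]
  have e1 : Fin S.card ≃ S := S.equivFin.symm
  have e2 : Fin (T.card + 1) ≃ Option T :=
    (Fintype.equivFinOfCardEq (by simp)).symm
  by_cases hle : S.card ≤ T.card + 1
  · exact hprop S.card (T.card + 1) hSpos (by omega) hcard (by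
      apply le_min <;> omega) (minor_transfer e1 e2 hminor)
  · exact hprop (T.card + 1) S.card (by omega) hSpos (by omega) (by
      apply le_min <;> omega) (minor_transfer e2 e1 (minor_swap hminor))


open Classical in
/-- Counting ordered adjacent pairs in `R` through a parent map without 2-cycles. -/
lemma count_pairs {V : Type} [Fintype V] (H : SimpleGraph V) (R D : Finset V) (hDR : D ⊆ R)
    (p : V → V) (hpR : ∀ w ∈ D, p w ∈ R) (hadj : ∀ w ∈ D, H.Adj w (p w))
    (hno : ∀ w ∈ D, p w ∈ D → p (p w) ≠ w) :
    2 * D.card ≤ ((R ×ˢ R).filter fun x => H.Adj x.1 x.2).card ∧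
    (((R ×ˢ R).filter fun x => H.Adj x.1 x.2).card = 2 * D.card →
      ∀ x ∈ R, ∀ y ∈ R, H.Adj x y → (x ∈ D ∧ p x = y) ∨ (y ∈ D ∧ p y = x)) := by
  set P1 : Finset (V × V) := D.image fun w => (w, p w) with hP1
  set P2 : Finset (V × V) := D.image fun w => (p w, w) with hP2
  have c1 : P1.card = D.card := Finset.card_image_of_injective _ (fun a b h => by simp_all)
  have c2 : P2.card = D.card := Finset.card_image_of_injective _ (fun a b h => by simp_all)
  have hd : Disjoint P1 P2 := by
    rw [Finset.disjoint_left]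
    rintro ⟨x, y⟩ h1 h2
    simp only [hP1, hP2, Finset.mem_image, Prod.mk.injEq] at h1 h2
    obtain ⟨w, hw, rfl, rfl⟩ := h1
    obtain ⟨z, hz, h3, rfl⟩ := h2
    exact hno _ hw hz h3
  have hsub : P1 ∪ P2 ⊆ (R ×ˢ R).filter fun x => H.Adj x.1 x.2 := by
    rintro ⟨x, y⟩ h
    simp only [hP1, hP2, Finset.mem_union, Finset.mem_image, Prod.mk.injEq] at h
    simp only [Finset.mem_filter, Finset.mem_product]
    rcases h with ⟨w, hw, rfl, rfl⟩ | ⟨w, hw, rfl, rfl⟩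
    · exact ⟨⟨hDR hw, hpR _ hw⟩, hadj _ hw⟩
    · exact ⟨⟨hpR _ hw, hDR hw⟩, (hadj _ hw).symm⟩
  have hc : (P1 ∪ P2).card = 2 * D.card := by
    rw [Finset.card_union_of_disjoint hd, c1, c2]; omega
  refine ⟨hc ▸ Finset.card_le_card hsub, fun heq x hx y hy hxy => ?_⟩
  have := Finset.eq_of_subset_of_card_le hsub (by rw [heq, hc])
  have h4 : (x, y) ∈ P1 ∪ P2 := by
    rw [this]; simp [hx, hy, hxy]
  simp only [hP1, hP2, Finset.mem_union, Finset.mem_image, Prod.mk.injEq] at h4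
  rcases h4 with ⟨w, hw, rfl, rfl⟩ | ⟨w, hw, rfl, rfl⟩ <;> simp [hw]

open Classical in
/-- Degree count around a vertex of degree two. -/
lemma count_two {V : Type} [Fintype V] (H : SimpleGraph V) (v a b : V) (hab : a ≠ b)
    (hv : ∀ x, H.Adj v x ↔ (x = a ∨ x = b)) (hcov : ∀ x, x ≠ v → x ≠ a → x ≠ b →
      H.Adj a x ∨ H.Adj b x) :
    ∃ R A B : Finset V, (∀ x, x ∈ R ↔ (x ≠ v ∧ x ≠ a ∧ x ≠ b)) ∧
      (∀ x, x ∈ A ↔ (x ≠ v ∧ x ≠ a ∧ x ≠ b ∧ ¬ H.Adj b x)) ∧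
      (∀ x, x ∈ B ↔ (x ≠ v ∧ x ≠ a ∧ x ≠ b ∧ ¬ H.Adj a x)) ∧
      2 * H.edgeFinset.card + 8 + 2 * (A.card + B.card) =
        4 * Fintype.card V + (if H.Adj a b then 2 else 0) +
          ((R ×ˢ R).filter fun x => H.Adj x.1 x.2).card := by
  have hva : v ≠ a := ((hv a).2 (Or.inl rfl)).ne
  have hvb : v ≠ b := ((hv b).2 (Or.inr rfl)).ne
  set R : Finset V := Finset.univ \ {v, a, b} with hR
  have hRm : ∀ x, x ∈ R ↔ (x ≠ v ∧ x ≠ a ∧ x ≠ b) := by intro x; simp [hR]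
  have hRc : R.card + 3 = Fintype.card V := by
    have h2 := Finset.card_sdiff_add_card_eq_card (Finset.subset_univ ({v, a, b} : Finset V))
    rw [Finset.card_eq_three.2 ⟨v, a, b, hva, hvb, hab, rfl⟩] at h2
    simpa using h2
  refine ⟨R, R.filter fun x => ¬ H.Adj b x, R.filter fun x => ¬ H.Adj a x, hRm, ?_, ?_, ?_⟩
  · intro x; simp [hRm]; tauto
  · intro x; simp [hRm]; tauto
  have hsplit : ∀ f : V → ℕ, ∑ x, f x = f v + f a + f b + ∑ x ∈ R, f x := by
    intro f
    rw [← Finset.sum_sdiff (Finset.subset_univ ({v, a, b} : Finset V))]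
    rw [Finset.sum_insert (by simp [hva, hvb]), Finset.sum_insert (by simp [hab]),
      Finset.sum_singleton, ← hR]
    omega
  have hdeg : ∀ x, H.degree x = ∑ y, if H.Adj x y then 1 else 0 := by
    intro x
    rw [← SimpleGraph.card_neighborFinset_eq_degree, Finset.sum_boole]
    simp [SimpleGraph.neighborFinset_eq_filter]
  have hsum := H.sum_degrees_eq_twice_card_edges
  rw [hsplit] at hsum
  have hdv : H.degree v = 2 := by
    rw [← SimpleGraph.card_neighborFinset_eq_degree, Finset.card_eq_two]
    exact ⟨a, b, hab, by ext x; simp [hv]⟩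
  have hvR : ∀ x ∈ R, ¬ H.Adj x v := by
    intro x hx h
    have := (hv x).1 h.symm
    have := (hRm x).1 hx
    tauto
  have e1 := hdeg a
  rw [hsplit] at e1
  have e2 := hdeg b
  rw [hsplit] at e2
  have e3 : ∑ x ∈ R, H.degree x = (∑ x ∈ R, if H.Adj a x then 1 else 0) +
      (∑ x ∈ R, if H.Adj b x then 1 else 0) +
      ((R ×ˢ R).filter fun x => H.Adj x.1 x.2).card := by
    rw [Finset.card_filter, Finset.sum_product, ← Finset.sum_add_distrib,
      ← Finset.sum_add_distrib]
    refine Finset.sum_congr rfl fun x hx => ?_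
    rw [hdeg, hsplit]
    simp [hvR x hx, H.adj_comm x a, H.adj_comm x b]
  have e4 : (R.filter fun x => ¬ H.Adj b x).card + (∑ x ∈ R, if H.Adj b x then 1 else 0)
      = R.card := by
    rw [Finset.sum_boole]
    have := Finset.card_filter_add_card_filter_not (s := R) (fun x => H.Adj b x)
    simp only [Nat.cast_id]
    omega
  have e5 : (R.filter fun x => ¬ H.Adj a x).card + (∑ x ∈ R, if H.Adj a x then 1 else 0)
      = R.card := by
    rw [Finset.sum_boole]
    have := Finset.card_filter_add_card_filter_not (s := R) (fun x => H.Adj a x)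
    simp only [Nat.cast_id]
    omega
  have hav : H.Adj a v := ((hv a).2 (Or.inl rfl)).symm
  have hbv : H.Adj b v := ((hv b).2 (Or.inr rfl)).symm
  simp only [hav, hbv, H.adj_comm b a, SimpleGraph.irrefl, if_true, if_false] at e1 e2
  rw [hdv, e1, e2, e3] at hsum
  split_ifs at hsum ⊢ <;> omega


/-- Local setting around a vertex `v` of degree two with neighbours `a`, `b`. -/
structure Loc {V : Type} (H : SimpleGraph V) (v a b : V) (R A B : Finset V) : Prop where
  diam : ∀ x y, x ≠ y → ¬ H.Adj x y → ∃ z, H.Adj x z ∧ H.Adj y z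
  hv : ∀ x, H.Adj v x ↔ (x = a ∨ x = b)
  cov : ∀ x, x ≠ v → x ≠ a → x ≠ b → H.Adj a x ∨ H.Adj b x
  mR : ∀ x, x ∈ R ↔ (x ≠ v ∧ x ≠ a ∧ x ≠ b)
  mA : ∀ x, x ∈ A ↔ (x ≠ v ∧ x ≠ a ∧ x ≠ b ∧ ¬ H.Adj b x)
  mB : ∀ x, x ∈ B ↔ (x ≠ v ∧ x ≠ a ∧ x ≠ b ∧ ¬ H.Adj a x)

lemma Loc.swap {V : Type} {H : SimpleGraph V} {v a b : V} {R A B : Finset V}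
    (h : Loc H v a b R A B) : Loc H v b a R B A := by
  obtain ⟨h1, h2, h3, h4, h5, h6⟩ := h
  exact ⟨h1, by grind, by grind, by grind, by grind, by grind⟩

open Classical in
lemma Loc.bound {V : Type} [Fintype V] {H : SimpleGraph V} {v a b : V} {R A B : Finset V}
    (h : Loc H v a b R A B) (hA : A.Nonempty) (hB : B.Nonempty) :
    2 * (A.card + B.card) ≤ ((R ×ˢ R).filter fun x => H.Adj x.1 x.2).card + 2 := by
  obtain ⟨h1, h2, h3, h4, h5, h6⟩ := h
  obtain ⟨x0, hx0⟩ := hA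
  obtain ⟨y0, hy0⟩ := hB
  have hdis : Disjoint A B := by
    rw [Finset.disjoint_left]; intro x hx hx'
    grind
  have hnvR : ∀ x ∈ R, ¬ H.Adj x v := by
    intro x hx hxv; have := (h2 x).1 hxv.symm; grind
  have hex : ∀ w, ∃ m, w ∈ A ∪ B → w ≠ x0 → m ∈ R ∧ H.Adj w m ∧ (H.Adj w x0 → m = x0) ∧
      (w ∈ B → ¬ H.Adj w x0 → H.Adj m x0) ∧
      (w ∈ A → ¬ H.Adj w x0 → m ∉ A ∨
        ((∀ z ∈ R, H.Adj w z → z ∈ A) ∧ ∃ z ∈ R, H.Adj m z ∧ z ∉ A)) := by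
    intro w
    by_cases hw : w ∈ A ∪ B
    swap
    · exact ⟨w, fun h => absurd h hw⟩
    by_cases hwx : w = x0
    · exact ⟨w, fun _ h => absurd hwx h⟩
    by_cases hadj : H.Adj w x0
    · exact ⟨x0, fun _ _ => ⟨by grind, hadj, fun _ => rfl, fun _ h => absurd hadj h,
        fun _ h => absurd hadj h⟩⟩
    by_cases hwB : w ∈ B
    · obtain ⟨m, hm1, hm2⟩ := h1 w x0 hwx hadj
      have hwA : w ∉ A := fun hh => Finset.disjoint_left.1 hdis hh hwB
      have : m ≠ v := by rintro rfl; exact hnvR w (by grind) hm1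
      have : m ≠ a := by rintro rfl; exact ((h6 w).1 hwB).2.2.2 hm1.symm
      have : m ≠ b := by rintro rfl; exact ((h5 x0).1 hx0).2.2.2 hm2.symm
      exact ⟨m, fun _ _ => ⟨by grind, hm1, fun h => absurd h hadj, fun _ _ => hm2.symm,
        fun h => absurd h hwA⟩⟩
    have hwA : w ∈ A := by grind
    by_cases hz : ∃ z ∈ R, H.Adj w z ∧ z ∉ A
    · obtain ⟨z, hz1, hz2, hz3⟩ := hz
      exact ⟨z, fun _ _ => ⟨hz1, hz2, fun h => absurd h hadj, fun h => absurd h hwB,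
        fun _ _ => Or.inl hz3⟩⟩
    push Not at hz
    have hy0A : y0 ∉ A := fun hh => Finset.disjoint_left.1 hdis hh hy0
    have hwy : ¬ H.Adj w y0 := fun hh => hy0A (hz y0 (by grind) hh)
    obtain ⟨m, hm1, hm2⟩ := h1 w y0 (by rintro rfl; exact hy0A hwA) hwy
    have : m ≠ v := by rintro rfl; exact hnvR w (by grind) hm1
    have : m ≠ b := by rintro rfl; exact ((h5 w).1 hwA).2.2.2 hm1.symm
    have : m ≠ a := by rintro rfl; exact ((h6 y0).1 hy0).2.2.2 hm2.symm
    exact ⟨m, fun _ _ => ⟨by grind, hm1, fun h => absurd h hadj, fun h => absurd h hwB,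
        fun _ _ => Or.inr ⟨hz, y0, by grind, hm2.symm, hy0A⟩⟩⟩
  choose p hp using hex
  have hc := (count_pairs H R ((A ∪ B).erase x0) (by grind) p
    (fun w hw => (hp w (by grind) (by grind)).1)
    (fun w hw => (hp w (by grind) (by grind)).2.1)
    (by
      intro w hw hw' hpp
      obtain ⟨a1, a2, a3, a4, a5⟩ := hp w (by grind) (by grind)
      obtain ⟨b1, b2, b3, b4, b5⟩ := hp (p w) (by grind) (by grind)
      rw [hpp] at b1 b2 b3 b4 b5
      grind)).1
  rw [Finset.card_erase_of_mem (by grind), Finset.card_union_of_disjoint hdis] at hc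
  omega

/-- Parent structure rooted at `x`. -/
def Par {V : Type} (H : SimpleGraph V) (R A B : Finset V) (x : V) (p : V → V) : Prop :=
  (∀ w, (w ∈ A ∨ w ∈ B) → w ≠ x → (p w ∈ R ∧ H.Adj w (p w) ∧ (H.Adj w x → p w = x) ∧
      (w ∈ B → ¬ H.Adj w x → H.Adj (p w) x) ∧ (w ∈ A → ¬ H.Adj w x → p w ∉ A))) ∧
  (∀ y ∈ R, ∀ z ∈ R, H.Adj y z →
    ((y ∈ A ∨ y ∈ B) ∧ y ≠ x ∧ p y = z) ∨ ((z ∈ A ∨ z ∈ B) ∧ z ≠ x ∧ p z = y))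

open Classical in
lemma Loc.par {V : Type} [Fintype V] {H : SimpleGraph V} {v a b : V} {R A B : Finset V}
    (h : Loc H v a b R A B) (hab : ¬ H.Adj a b) (hne : a ≠ b)
    (heq : ((R ×ˢ R).filter fun x => H.Adj x.1 x.2).card + 2 = 2 * (A.card + B.card))
    (x0 : V) (hx0 : x0 ∈ A) : ∃ p, Par H R A B x0 p := by
  obtain ⟨h1, h2, h3, h4, h5, h6⟩ := h
  have hdis : Disjoint A B := by
    rw [Finset.disjoint_left]; intro x hx hx'
    grind
  have hnvR : ∀ x ∈ R, ¬ H.Adj x v := by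
    intro x hx hxv; have := (h2 x).1 hxv.symm; grind
  have hex : ∀ w, ∃ m, (w ∈ A ∨ w ∈ B) → w ≠ x0 → m ∈ R ∧ H.Adj w m ∧ (H.Adj w x0 → m = x0) ∧
      (w ∈ B → ¬ H.Adj w x0 → H.Adj m x0) ∧
      (w ∈ A → ¬ H.Adj w x0 → m ∉ A) := by
    intro w
    by_cases hw : w ∈ A ∨ w ∈ B
    swap
    · exact ⟨w, fun h => absurd h hw⟩
    by_cases hwx : w = x0
    · exact ⟨w, fun _ h => absurd hwx h⟩
    by_cases hadj : H.Adj w x0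
    · exact ⟨x0, fun _ _ => ⟨by grind, hadj, fun _ => rfl, fun _ h => absurd hadj h,
        fun _ h => absurd hadj h⟩⟩
    by_cases hwB : w ∈ B
    · obtain ⟨m, hm1, hm2⟩ := h1 w x0 hwx hadj
      have hwA : w ∉ A := fun hh => Finset.disjoint_left.1 hdis hh hwB
      have : m ≠ v := by rintro rfl; exact hnvR w (by grind) hm1
      have : m ≠ a := by rintro rfl; exact ((h6 w).1 hwB).2.2.2 hm1.symm
      have : m ≠ b := by rintro rfl; exact ((h5 x0).1 hx0).2.2.2 hm2.symm
      exact ⟨m, fun _ _ => ⟨by grind, hm1, fun h => absurd h hadj, fun _ _ => hm2.symm,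
        fun h => absurd h hwA⟩⟩
    have hwA : w ∈ A := by grind
    obtain ⟨m, hm1, hm2⟩ := h1 w b (by grind) (fun hh => ((h5 w).1 hwA).2.2.2 hh.symm)
    have : m ≠ v := by rintro rfl; exact hnvR w (by grind) hm1
    have : m ≠ b := by rintro rfl; exact hm2.ne rfl
    have : m ≠ a := by rintro rfl; exact hab hm2.symm
    exact ⟨m, fun _ _ => ⟨by grind, hm1, fun h => absurd h hadj, fun h => absurd h hwB,
        fun _ _ hh => ((h5 m).1 hh).2.2.2 hm2⟩⟩
  choose p hp using hex
  refine ⟨p, hp, ?_⟩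
  have hc := (count_pairs H R ((A ∪ B).erase x0) (by grind) p
    (fun w hw => (hp w (by grind) (by grind)).1)
    (fun w hw => (hp w (by grind) (by grind)).2.1)
    (by
      intro w hw hw' hpp
      obtain ⟨a1, a2, a3, a4, a5⟩ := hp w (by grind) (by grind)
      obtain ⟨b1, b2, b3, b4, b5⟩ := hp (p w) (by grind) (by grind)
      rw [hpp] at b1 b2 b3 b4 b5
      grind)).2
  rw [Finset.card_erase_of_mem (by grind), Finset.card_union_of_disjoint hdis] at hc
  intro y hy z hz hyz
  have := hc (by omega) y hy z hz hyz
  grind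

lemma Par.swap {V : Type} {H : SimpleGraph V} {R A B : Finset V} {x : V} {p : V → V}
    (h : Par H R B A x p) : 
  (∀ w, (w ∈ A ∨ w ∈ B) → w ≠ x → (H.Adj w x → p w = x)) ∧
  (∀ y ∈ R, ∀ z ∈ R, H.Adj y z →
    ((y ∈ A ∨ y ∈ B) ∧ y ≠ x ∧ p y = z) ∨ ((z ∈ A ∨ z ∈ B) ∧ z ≠ x ∧ p z = y)) := by
  obtain ⟨h1, h2⟩ := h
  constructor
  · intro w hw hne
    exact (h1 w hw.symm hne).2.2.1
  · intro y hy z hz hyz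
    have := h2 y hy z hz hyz
    tauto

/-- Tree-like facts in the equality case. -/
structure TreeFacts {V : Type} (H : SimpleGraph V) (R A B : Finset V) : Prop where
  iso : ∀ x ∈ R, ∀ y ∈ R, H.Adj x y → (x ∈ A ∨ x ∈ B) ∧ (y ∈ A ∨ y ∈ B)
  tri : ∀ x y z, x ∈ R → y ∈ R → z ∈ R → H.Adj x y → H.Adj y z → H.Adj x z → False
  c4 : ∀ x y z w, x ∈ R → y ∈ R → z ∈ R → w ∈ R → H.Adj x y → H.Adj y z → H.Adj z w →
    H.Adj x w → x ≠ z → y = w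

lemma treeFacts {V : Type} {H : SimpleGraph V} {R A B : Finset V}
    (hne : ∃ r, r ∈ A ∨ r ∈ B)
    (h1 : ∀ x ∈ A, ∃ p, Par H R A B x p) (h2 : ∀ x ∈ B, ∃ p, Par H R B A x p) :
    TreeFacts H R A B := by
  have key : ∀ x, (x ∈ A ∨ x ∈ B) → ∃ p : V → V,
    (∀ w, (w ∈ A ∨ w ∈ B) → w ≠ x → (H.Adj w x → p w = x)) ∧
    (∀ y ∈ R, ∀ z ∈ R, H.Adj y z →
      ((y ∈ A ∨ y ∈ B) ∧ y ≠ x ∧ p y = z) ∨ ((z ∈ A ∨ z ∈ B) ∧ z ≠ x ∧ p z = y)) := by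
    rintro x (hx | hx)
    · obtain ⟨p, hp⟩ := h1 x hx
      refine ⟨p, ?_, hp.2⟩
      intro w hw hne
      exact (hp.1 w hw hne).2.2.1
    · obtain ⟨p, hp⟩ := h2 x hx
      exact ⟨p, hp.swap⟩
  have e1 : ∀ x ∈ R, ∀ y ∈ R, H.Adj x y → (x ∈ A ∨ x ∈ B) → (y ∈ A ∨ y ∈ B) := by
    intro x hx y hy hxy hxx
    obtain ⟨p, hp1, hp2⟩ := key x hxx
    rcases hp2 x hx y hy hxy with h | h
    · exact absurd rfl h.2.1
    · exact h.1
  have e2 : ∀ x ∈ R, ∀ y ∈ R, H.Adj x y → (x ∈ A ∨ x ∈ B) ∧ (y ∈ A ∨ y ∈ B) := by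
    intro x hx y hy hxy
    obtain ⟨r, hr⟩ := hne
    obtain ⟨p, hp1, hp2⟩ := key r hr
    rcases hp2 x hx y hy hxy with h | h
    · exact ⟨h.1, e1 x hx y hy hxy h.1⟩
    · exact ⟨e1 y hy x hx hxy.symm h.1, h.1⟩
  refine ⟨e2, ?_, ?_⟩
  · intro x y z hx hy hz hxy hyz hxz
    obtain ⟨p, hp1, hp2⟩ := key x (e2 x hx y hy hxy).1
    have a1 := hp1 y (e2 x hx y hy hxy).2 hxy.ne' hxy.symm
    have a2 := hp1 z (e2 x hx z hz hxz).2 hxz.ne' hxz.symm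
    have := hp2 y hy z hz hyz
    have := hxy.ne
    have := hxz.ne
    grind
  · intro x y z w hx hy hz hw hxy hyz hzw hxw hne
    obtain ⟨p, hp1, hp2⟩ := key x (e2 x hx y hy hxy).1
    have a1 := hp1 y (e2 x hx y hy hxy).2 hxy.ne' hxy.symm
    have a2 := hp1 w (e2 x hx w hw hxw).2 hxw.ne' hxw.symm
    have := hp2 y hy z hz hyz
    have := hp2 z hz w hw hzw
    grind


lemma Loc.third {V : Type} {H : SimpleGraph V} {v a b : V} {R A B : Finset V}
    (hT : TreeFacts H R A B)
    (hAR : ∀ x ∈ A, x ∈ R) (hBR : ∀ x ∈ B, x ∈ R) (hdis : ∀ x ∈ A, x ∉ B)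
    (hd : ∀ x ∈ A, ∀ y ∈ B, H.Adj x y ∨ ∃ m ∈ R, H.Adj x m ∧ H.Adj m y)
    (hAB : ∀ x ∈ A, ∃ y ∈ B, H.Adj x y)
    {x y : V} (hx : x ∈ A) (hy : y ∈ A) (hxy : H.Adj x y)
    (hp : ∃ p, Par H R A B x p) :
    ∀ z ∈ A, z = x ∨ z = y := by
  intro z hz
  by_contra hcon
  push Not at hcon
  obtain ⟨hzx, hzy⟩ := hcon
  obtain ⟨p, hp1, hp2⟩ := hp
  obtain ⟨x', hx', hxx'⟩ := hAB x hx
  obtain ⟨y', hy', hyy'⟩ := hAB y hy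
  obtain ⟨iso, tri, c4⟩ := hT
  have hxR := hAR x hx
  have hyR := hAR y hy
  have hzR := hAR z hz
  have hx'R := hBR x' hx'
  have hy'R := hBR y' hy'
  have n1 : x' ≠ y' := by
    rintro rfl
    exact tri x y x' hxR hyR hx'R hxy hyy' hxx'
  have n2 : ¬ H.Adj x y' := fun h => tri x y y' hxR hyR hy'R hxy hyy' h
  have n3 : ¬ H.Adj y x' := fun h => tri x y x' hxR hyR hx'R hxy h hxx'
  have n4 : ¬ H.Adj x' y' := fun h => by
    have := c4 x x' y' y hxR hx'R hy'R hyR hxx' h hyy'.symm hxy (by grind)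
    grind
  have py' : p y' = y := by
    have := hp2 y hyR y' hy'R hyy'
    have := (hp1 y (Or.inl hy) hxy.ne').2.2.1 hxy.symm
    grind
  have pex' : p x' = x := (hp1 x' (Or.inr hx') (by grind)).2.2.1 hxx'.symm
  have pey : p y = x := (hp1 y (Or.inl hy) (by grind)).2.2.1 hxy.symm
  have hzx' : ¬ H.Adj z x := by
    intro hzx1
    have pz : p z = x := (hp1 z (Or.inl hz) hzx).2.2.1 hzx1
    rcases hd z hz y' hy' with h | ⟨m, hm, hm1, hm2⟩
    · have := hp2 z hzR y' hy'R h
      grind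
    · have e1 := hp2 z hzR m hm hm1
      have e2 := hp2 m hm y' hy'R hm2
      have : m ≠ x := by rintro rfl; exact n2 hm2
      have : m ≠ y := by rintro rfl; exact tri z m x hzR hyR hxR hm1 hxy.symm hzx1
      grind
  obtain ⟨q1, q2, q3, q4, q5⟩ := hp1 z (Or.inl hz) hzx
  have q6 := q5 hz hzx'
  rcases hd z hz y' hy' with h | ⟨m, hm, hm1, hm2⟩
  · have e1 : p z = y' := by
      have := hp2 z hzR y' hy'R h
      grind
    rcases hd z hz x' hx' with h' | ⟨m, hm, hm1, hm2⟩
    · have := hp2 z hzR x' hx'R h'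
      grind
    · have e3 := hp2 z hzR m hm hm1
      have e4 := hp2 m hm x' hx'R hm2
      have : m ≠ x := by rintro rfl; exact hzx' hm1
      have e5 : p m = x' := by grind
      grind
  · have e3 := hp2 z hzR m hm hm1
    have e4 := hp2 m hm y' hy'R hm2
    by_cases hmy : m = y
    · grind
    · have e5 : p m = y' := by grind
      have e6 : p z = m := by grind
      have e7 : m ∈ B := by grind
      have e8 : m ≠ x := by grind
      have e9 := hp1 m (Or.inr e7) e8
      by_cases h10 : H.Adj m x
      · grind
      · have := e9.2.2.2.1 e7 h10
        rw [e5] at this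
        exact n2 this.symm

def C5S {V : Type} (H : SimpleGraph V) : Prop :=
  ∃ w u1 u2 : V, w ≠ u2 ∧ u1 ≠ u2 ∧ H.Adj w u1 ∧ ¬ H.Adj u1 u2 ∧ ¬ H.Adj w u2 ∧
    (∀ z, z ≠ w → z ≠ u1 → z ≠ u2 → H.Adj u2 z ∧ (H.Adj w z ↔ ¬ H.Adj u1 z)) ∧
    (∀ z z', z ≠ w → z ≠ u1 → z ≠ u2 → z' ≠ w → z' ≠ u1 → z' ≠ u2 → ¬ H.Adj z z')

def TriS {V : Type} (H : SimpleGraph V) : Prop :=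
  ∃ b a x y : V, b ≠ a ∧ b ≠ x ∧ b ≠ y ∧ a ≠ x ∧ a ≠ y ∧ x ≠ y ∧
    ¬ H.Adj b a ∧ ¬ H.Adj b x ∧ ¬ H.Adj b y ∧
    (∀ z, z ≠ b → z ≠ a → z ≠ x → z ≠ y → 
      (H.Adj a z ∧ ¬ H.Adj x z ∧ ¬ H.Adj y z) ∨ (¬ H.Adj a z ∧ H.Adj x z ∧ ¬ H.Adj y z) ∨
      (¬ H.Adj a z ∧ ¬ H.Adj x z ∧ H.Adj y z)) ∧
    (∀ z z', z ≠ b → z ≠ a → z ≠ x → z ≠ y → z' ≠ b → z' ≠ a → z' ≠ x → z' ≠ y →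
      ¬ H.Adj z z')

lemma Loc.dist {V : Type} {H : SimpleGraph V} {v a b : V} {R A B : Finset V}
    (h : Loc H v a b R A B) (x : V) (hx : x ∈ A) (y : V) (hy : y ∈ B) :
    H.Adj x y ∨ ∃ m ∈ R, H.Adj x m ∧ H.Adj m y := by
  obtain ⟨h1, h2, h3, h4, h5, h6⟩ := h
  by_cases hxy : H.Adj x y
  · exact Or.inl hxy
  right
  have hne : x ≠ y := by rintro rfl; grind
  obtain ⟨m, hm1, hm2⟩ := h1 x y hne hxy
  have := h5 x
  have := h6 y
  have := h2 x
  exact ⟨m, (h4 m).2 (by grind [SimpleGraph.adj_comm]), hm1, hm2.symm⟩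

lemma Loc.nbr {V : Type} {H : SimpleGraph V} {v a b : V} {R A B : Finset V}
    (h : Loc H v a b R A B) (hab : ¬ H.Adj a b) (x : V) (hx : x ∈ A) :
    ∃ y ∈ R, y ∉ A ∧ H.Adj x y := by
  obtain ⟨h1, h2, h3, h4, h5, h6⟩ := h
  obtain ⟨m, hm1, hm2⟩ := h1 x b (by grind) (fun hh => ((h5 x).1 hx).2.2.2 hh.symm)
  have e1 : m ≠ v := by
    rintro rfl
    have := (h2 x).1 hm1.symm
    grind
  have e2 : m ≠ b := by rintro rfl; exact hm2.ne rfl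
  have e3 : m ≠ a := by rintro rfl; exact hab hm2.symm
  exact ⟨m, by grind, by grind, hm1⟩

/-- A-A edge gives the triangle structure. -/
lemma Loc.tri {V : Type} {H : SimpleGraph V} {v a b : V} {R A B : Finset V}
    (h : Loc H v a b R A B) (hab : ¬ H.Adj a b) (hne : a ≠ b) (hT : TreeFacts H R A B)
    {x y : V} (hx : x ∈ A) (hy : y ∈ A) (hxy : H.Adj x y)
    (hp : ∃ p, Par H R A B x p) : TriS H := by
  have hd := h.dist
  have hAR : ∀ x ∈ A, x ∈ R := by intro x hx; have := h.mR x; have := h.mA x; grind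
  have hBR : ∀ x ∈ B, x ∈ R := by intro x hx; have := h.mR x; have := h.mB x; grind
  have hdis : ∀ x ∈ A, x ∉ B := by
    intro x hx; have := h.cov x; have := h.mA x; have := h.mB x; grind
  have hAB : ∀ x ∈ A, ∃ y ∈ B, H.Adj x y := by
    intro x hx
    obtain ⟨m, hm, hm1, hm2⟩ := h.nbr hab x hx
    exact ⟨m, by have := hT.iso x (hAR x hx) m hm hm2; grind, hm2⟩
  have hBA : ∀ x ∈ B, ∃ y ∈ A, H.Adj x y := by
    intro x hx
    obtain ⟨m, hm, hm1, hm2⟩ := h.swap.nbr (fun hh => hab hh.symm) x hx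
    exact ⟨m, by have := hT.iso x (hBR x hx) m hm hm2; grind, hm2⟩
  have h3 := Loc.third (v := v) (a := a) (b := b) hT hAR hBR hdis hd hAB hx hy hxy hp
  obtain ⟨iso, tri, c4⟩ := hT
  obtain ⟨k1, k2, k3, k4, k5, k6⟩ := h
  have hxR := hAR x hx
  have hyR := hAR y hy
  have hBc : ∀ z ∈ B, (H.Adj x z ∧ ¬ H.Adj y z) ∨ (¬ H.Adj x z ∧ H.Adj y z) := by
    intro z hz
    obtain ⟨m, hm, hm1⟩ := hBA z hz
    have := tri x y z hxR hyR (hBR z hz) hxy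
    have := hm1.symm
    rcases h3 m hm with rfl | rfl <;> tauto
  have hBB : ∀ z ∈ B, ∀ z' ∈ B, ¬ H.Adj z z' := by
    intro z hz z' hz' hzz
    have hzR := hBR z hz
    have hzR' := hBR z' hz'
    rcases hBc z hz with h1 | h1 <;> rcases hBc z' hz' with h2 | h2
    · exact tri x z z' hxR hzR hzR' h1.1 hzz h2.1
    · have := c4 x z z' y hxR hzR hzR' hyR h1.1 hzz h2.2.symm hxy (by grind)
      grind
    · have := c4 y z z' x hyR hzR hzR' hxR h1.2 hzz h2.1.symm hxy.symm (by grind)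
      grind
    · exact tri y z z' hyR hzR hzR' h1.2 hzz h2.2
  have hav : H.Adj a v := ((k2 a).2 (Or.inl rfl)).symm
  have hcl : ∀ z, z ≠ b → z ≠ a → z ≠ x → z ≠ y → z ∈ B ∨ (H.Adj a z ∧
      ∀ w, H.Adj z w → w = a ∨ w = b) := by
    intro z hzb hza hzx hzy
    by_cases hzB : z ∈ B
    · exact Or.inl hzB
    right
    by_cases hzv : z = v
    · subst hzv
      exact ⟨hav, fun w hw => (k2 w).1 hw⟩
    have hzA : z ∉ A := fun hh => by have := h3 z hh; tauto
    have hzR : z ∈ R := by grind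
    refine ⟨by grind, fun w hw => ?_⟩
    by_contra hcon
    push Not at hcon
    have hwv : w ≠ v := by
      rintro rfl
      have := (k2 z).1 hw.symm
      tauto
    have := iso z hzR w (by grind) hw
    tauto
  have xk := (k5 x).1 hx
  have yk := (k5 y).1 hy
  refine ⟨b, a, x, y, hne.symm, xk.2.2.1.symm, yk.2.2.1.symm, xk.2.1.symm, yk.2.1.symm, hxy.ne,
    fun hh => hab hh.symm, xk.2.2.2, yk.2.2.2, ?_, ?_⟩
  · intro z hzb hza hzx hzy
    rcases hcl z hzb hza hzx hzy with hz | ⟨hz, hz'⟩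
    · have := hBc z hz
      have := (k6 z).1 hz
      tauto
    · left
      refine ⟨hz, fun hh => ?_, fun hh => ?_⟩
      · have := hz' x hh.symm
        tauto
      · have := hz' y hh.symm
        tauto
  · intro z z' hzb hza hzx hzy hzb' hza' hzx' hzy' hzz
    rcases hcl z hzb hza hzx hzy with hz | ⟨hz, hz'⟩
    · rcases hcl z' hzb' hza' hzx' hzy' with hw | ⟨hw, hw'⟩
      · exact hBB z hz z' hw hzz
      · have := hw' z hzz.symm
        tauto
    · have := hz' z' hzz
      tauto

/-- A singleton class (and no inner edges) gives the five-cycle structure. -/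
lemma Loc.c5 {V : Type} {H : SimpleGraph V} {v a b : V} {R A B : Finset V}
    (h : Loc H v a b R A B) (hab : ¬ H.Adj a b) (hne : a ≠ b) (hT : TreeFacts H R A B)
    {w : V} (hw : w ∈ A) (hA : ∀ z ∈ A, z = w) (hBw : ∀ z ∈ B, H.Adj w z)
    (hBB : ∀ z ∈ B, ∀ z' ∈ B, ¬ H.Adj z z') : C5S H := by
  obtain ⟨k1, k2, k3, k4, k5, k6⟩ := h
  have wk := (k5 w).1 hw
  have hwv : ¬ H.Adj w v := fun hh => by have := (k2 w).1 hh.symm; tauto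
  have hav : H.Adj a v := ((k2 a).2 (Or.inl rfl)).symm
  have hbv : H.Adj b v := ((k2 b).2 (Or.inr rfl)).symm
  refine ⟨w, a, b, wk.2.2.1, hne, ?_, hab, fun hh => wk.2.2.2 hh.symm, ?_, ?_⟩
  · have := k3 w wk.1 wk.2.1 wk.2.2.1
    exact (this.resolve_right wk.2.2.2).symm
  · intro z hzw hza hzb
    by_cases hzv : z = v
    · subst hzv; tauto
    have hzA : z ∉ A := fun hh => hzw (hA z hh)
    refine ⟨by grind, fun hh => ?_, fun hh => hBw z (by grind)⟩
    have := hT.iso w (by grind) z (by grind) hh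
    grind
  · intro z z' hzw hza hzb hzw' hza' hzb' hzz
    have e1 : z ≠ v := by rintro rfl; have := (k2 z').1 hzz; tauto
    have e2 : z' ≠ v := by rintro rfl; have := (k2 z).1 hzz.symm; tauto
    have := hT.iso z (by grind) z' (by grind) hzz
    grind

open Classical in
lemma case_two {V : Type} [Fintype V] (H : SimpleGraph V)
    (diam : ∀ x y, x ≠ y → ¬ H.Adj x y → ∃ z, H.Adj x z ∧ H.Adj y z)
    (nodom : ∀ x, ∃ y, y ≠ x ∧ ¬ H.Adj x y) (v : V) (hv2 : H.degree v = 2) :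
    2 * Fintype.card V ≤ H.edgeFinset.card + 5 ∧
    (H.edgeFinset.card + 5 = 2 * Fintype.card V → C5S H ∨ TriS H) := by
  rw [← SimpleGraph.card_neighborFinset_eq_degree, Finset.card_eq_two] at hv2
  obtain ⟨a, b, hne, hN⟩ := hv2
  have hv : ∀ x, H.Adj v x ↔ (x = a ∨ x = b) := by
    intro x
    rw [← SimpleGraph.mem_neighborFinset, hN]; simp
  have cov : ∀ x, x ≠ v → x ≠ a → x ≠ b → H.Adj a x ∨ H.Adj b x := by
    intro x h1 h2 h3
    obtain ⟨z, hz1, hz2⟩ := diam v x h1.symm (by rw [hv]; tauto)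
    rcases (hv z).1 hz1 with rfl | rfl
    · exact Or.inl hz2.symm
    · exact Or.inr hz2.symm
  obtain ⟨R, A, B, mR, mA, mB, hcount⟩ := count_two H v a b hne hv cov
  have hL : Loc H v a b R A B := ⟨diam, hv, cov, mR, mA, mB⟩
  have hAR : ∀ x ∈ A, x ∈ R := by intro x hx; have := hL.mR x; have := hL.mA x; grind
  have hBR : ∀ x ∈ B, x ∈ R := by intro x hx; have := hL.mR x; have := hL.mB x; grind
  have hav : H.Adj a v := ((hv a).2 (Or.inl rfl)).symm
  have hbv : H.Adj b v := ((hv b).2 (Or.inr rfl)).symm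
  have hdis : ∀ x ∈ A, x ∉ B := by
    intro x hx; have := hL.cov x; have := hL.mA x; have := hL.mB x; grind
  by_cases hab : H.Adj a b
  · have hBne : B.Nonempty := by
      obtain ⟨y, hy, hy'⟩ := nodom a
      exact ⟨y, by grind⟩
    have hAne : A.Nonempty := by
      obtain ⟨y, hy, hy'⟩ := nodom b
      exact ⟨y, by grind [SimpleGraph.adj_comm]⟩
    have := hL.bound hAne hBne
    rw [if_pos hab] at hcount
    omega
  rw [if_neg hab] at hcount
  by_cases hAne : A.Nonempty
  swap
  · rw [Finset.not_nonempty_iff_eq_empty] at hAne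
    have hex : ∀ x, ∃ y, x ∈ B → y ∈ R ∧ y ∉ B ∧ H.Adj x y := by
      intro x
      by_cases hx : x ∈ B
      · obtain ⟨y, hy⟩ := hL.swap.nbr (fun hh => hab hh.symm) x hx
        exact ⟨y, fun _ => hy⟩
      · exact ⟨x, fun hh => absurd hh hx⟩
    choose p hp using hex
    have := (count_pairs H R B hBR p (fun w hw => (hp w hw).1) (fun w hw => (hp w hw).2.2)
      (fun w hw hw' => absurd hw' (hp w hw).2.1)).1
    rw [hAne, Finset.card_empty] at hcount
    omega
  by_cases hBne : B.Nonempty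
  swap
  · rw [Finset.not_nonempty_iff_eq_empty] at hBne
    have hex : ∀ x, ∃ y, x ∈ A → y ∈ R ∧ y ∉ A ∧ H.Adj x y := by
      intro x
      by_cases hx : x ∈ A
      · obtain ⟨y, hy⟩ := hL.nbr hab x hx
        exact ⟨y, fun _ => hy⟩
      · exact ⟨x, fun hh => absurd hh hx⟩
    choose p hp using hex
    have := (count_pairs H R A hAR p (fun w hw => (hp w hw).1) (fun w hw => (hp w hw).2.2)
      (fun w hw hw' => absurd hw' (hp w hw).2.1)).1
    rw [hBne, Finset.card_empty] at hcount
    omega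
  have hbd := hL.bound hAne hBne
  refine ⟨by omega, fun heq => ?_⟩
  have hba : ¬ H.Adj b a := fun hh => hab hh.symm
  have par1 : ∀ x ∈ A, ∃ p, Par H R A B x p :=
    fun x hx => hL.par hab hne (by omega) x hx
  have par2 : ∀ x ∈ B, ∃ p, Par H R B A x p :=
    fun x hx => hL.swap.par hba hne.symm (by omega) x hx
  have hT : TreeFacts H R A B := treeFacts (by obtain ⟨r, hr⟩ := hAne; exact ⟨r, Or.inl hr⟩)
    par1 par2
  have hT' : TreeFacts H R B A := ⟨fun x hx y hy hxy => by
    have := hT.iso x hx y hy hxy; tauto, hT.tri, hT.c4⟩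
  by_cases hAA : ∃ x ∈ A, ∃ y ∈ A, H.Adj x y
  · obtain ⟨x, hx, y, hy, hxy⟩ := hAA
    exact Or.inr (hL.tri hab hne hT hx hy hxy (par1 x hx))
  by_cases hBB : ∃ x ∈ B, ∃ y ∈ B, H.Adj x y
  · obtain ⟨x, hx, y, hy, hxy⟩ := hBB
    exact Or.inr (hL.swap.tri hba hne.symm hT' hx hy hxy (par2 x hx))
  push Not at hAA hBB
  left
  have hcomp : ∀ x ∈ A, ∀ y ∈ B, H.Adj x y := by
    intro x hx y hy
    rcases hL.dist x hx y hy with h | ⟨m, hm, hm1, hm2⟩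
    · exact h
    · rcases (hT.iso x (hAR x hx) m hm hm1).2 with h | h
      · exact absurd hm1 (hAA x hx m h)
      · exact absurd hm2 (hBB m h y hy)
  obtain ⟨x, hx⟩ := hAne
  obtain ⟨y, hy⟩ := hBne
  by_cases hA1 : ∀ z ∈ A, z = x
  · exact hL.c5 hab hne hT hx hA1 (hcomp x hx) hBB
  push Not at hA1
  obtain ⟨z, hz, hzx⟩ := hA1
  refine hL.swap.c5 hba hne.symm hT' hy (fun w hw => ?_) (fun w hw => (hcomp w hw y hy).symm) hAA
  exact hT.c4 x w z y (hAR x hx) (hBR w hw) (hAR z hz) (hBR y hy) (hcomp x hx w hw)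
    (hcomp z hz w hw).symm (hcomp z hz y hy) (hcomp x hx y hy) hzx.symm


open Classical in
lemma case_three_local {V : Type} [Fintype V] (H : SimpleGraph V)
    (diam : ∀ x y, x ≠ y → ¬ H.Adj x y → ∃ z, H.Adj x z ∧ H.Adj y z)
    (hmin : ∀ x, 3 ≤ H.degree x) (v : V) (hv3 : H.degree v = 3) :
    4 * Fintype.card V ≤ 2 * H.edgeFinset.card + 10 ∧
    (2 * H.edgeFinset.card + 10 = 4 * Fintype.card V →
      (∀ y, y ≠ v → ¬ H.Adj v y → H.degree y = 3) ∧
      (∑ x ∈ H.neighborFinset v, H.degree x + 1 = Fintype.card V) ∧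
      (∀ y, H.Adj v y → H.neighborFinset v ∩ H.neighborFinset y = ∅) ∧
      (∀ y, y ≠ v → ¬ H.Adj v y → (H.neighborFinset v ∩ H.neighborFinset y).card = 1)) := by
  set N := H.neighborFinset v with hN
  have hvN : v ∉ N := by simp [hN]
  have hNc : N.card = 3 := hv3
  set Q : Finset V := Finset.univ \ insert v N with hQ
  have hQm : ∀ y, y ∈ Q ↔ (y ≠ v ∧ ¬ H.Adj v y) := by intro y; simp [hQ, hN]
  have hQc : Q.card + 4 = Fintype.card V := by
    have h2 := Finset.card_sdiff_add_card_eq_card (Finset.subset_univ (insert v N))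
    rw [Finset.card_insert_of_notMem hvN, hNc, ← hQ] at h2
    simpa using h2
  have hsplit : ∀ f : V → ℕ, ∑ x, f x = f v + ∑ x ∈ N, f x + ∑ x ∈ Q, f x := by
    intro f
    rw [← Finset.sum_sdiff (Finset.subset_univ (insert v N)), Finset.sum_insert hvN, ← hQ]
    omega
  have hdeg : ∀ x, H.degree x = ∑ y, if H.Adj x y then 1 else 0 := by
    intro x
    rw [← SimpleGraph.card_neighborFinset_eq_degree, Finset.sum_boole]
    simp [SimpleGraph.neighborFinset_eq_filter]
  have hsum := H.sum_degrees_eq_twice_card_edges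
  rw [hsplit, hv3] at hsum
  have hNs : ∑ x ∈ N, H.degree x = ∑ y, (N ∩ H.neighborFinset y).card := by
    simp_rw [hdeg]
    rw [Finset.sum_comm]
    refine Finset.sum_congr rfl fun y _ => ?_
    rw [Finset.sum_boole]
    simp only [Nat.cast_id]
    congr 1
    ext x
    simp [H.adj_comm]
  have hcv : (N ∩ H.neighborFinset v).card = 3 := by rw [← hN, Finset.inter_self, hNc]
  rw [hsplit, hcv] at hNs
  have hq1 : ∀ y ∈ Q, 1 ≤ (N ∩ H.neighborFinset y).card := by
    intro y hy
    rw [hQm] at hy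
    obtain ⟨z, hz1, hz2⟩ := diam v y hy.1.symm hy.2
    exact Finset.card_pos.2 ⟨z, by simp [hN, hz1, hz2]⟩
  have s1 : ∑ y ∈ Q, 1 ≤ ∑ y ∈ Q, (N ∩ H.neighborFinset y).card := Finset.sum_le_sum hq1
  have s2 : ∑ y ∈ Q, 3 ≤ ∑ y ∈ Q, H.degree y := Finset.sum_le_sum fun y _ => hmin y
  have s1' : ∑ y ∈ Q, 1 = Q.card := by simp
  have s2' : ∑ y ∈ Q, 3 = 3 * Q.card := by simp [mul_comm]
  refine ⟨by omega, fun heq => ⟨?_, by omega, ?_, ?_⟩⟩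
  · intro y hy1 hy2
    exact ((Finset.sum_eq_sum_iff_of_le (fun y _ => hmin y)).1
      (show ∑ y ∈ Q, 3 = ∑ y ∈ Q, H.degree y by omega) y ((hQm y).2 ⟨hy1, hy2⟩)).symm
  · intro y hy
    have h0 : ∑ y ∈ N, (N ∩ H.neighborFinset y).card = 0 := by omega
    rw [Finset.sum_eq_zero_iff] at h0
    exact Finset.card_eq_zero.1 (h0 y (by simpa [hN] using hy))
  · intro y hy1 hy2
    exact ((Finset.sum_eq_sum_iff_of_le hq1).1
      (show ∑ y ∈ Q, 1 = ∑ y ∈ Q, (N ∩ H.neighborFinset y).card by omega) y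
        ((hQm y).2 ⟨hy1, hy2⟩)).symm

def pg : Fin 10 → {s : Finset (Fin 5) // s.card = 2} :=
  ![⟨{0, 1}, rfl⟩, ⟨{2, 3}, rfl⟩, ⟨{2, 4}, rfl⟩, ⟨{3, 4}, rfl⟩, ⟨{0, 4}, rfl⟩, ⟨{1, 4}, rfl⟩,
    ⟨{1, 3}, rfl⟩, ⟨{0, 3}, rfl⟩, ⟨{1, 2}, rfl⟩, ⟨{0, 2}, rfl⟩]

def pnb : Fin 10 → Fin 3 → Fin 10 :=
  ![![1, 2, 3], ![0, 4, 5], ![0, 6, 7], ![0, 8, 9], ![1, 6, 8], ![1, 7, 9], ![2, 4, 9],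
    ![2, 5, 8], ![3, 4, 7], ![3, 5, 6]]

lemma pg_bij : Function.Bijective pg := by
  rw [Fintype.bijective_iff_injective_and_card]
  constructor
  · decide
  · rw [Fintype.card_fin]; decide

lemma pg_adj (i j : Fin 10) : petersen.Adj (pg i) (pg j) ↔ ∃ k, pnb i k = j := by
  simp only [petersen, SimpleGraph.fromRel_adj]
  revert i j
  decide

lemma pnb_inj (i : Fin 10) : Function.Injective (pnb i) := by
  revert i; decide

open Classical in
lemma petersen_iso {V : Type} [Fintype V] (H : SimpleGraph V) (hc : Fintype.card V = 10)
    (h3 : ∀ x, H.degree x = 3)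
    (diam : ∀ x y, x ≠ y → ¬ H.Adj x y → ∃ z, H.Adj x z ∧ H.Adj y z)
    (tri : ∀ x y z, H.Adj x y → H.Adj y z → H.Adj x z → False)
    (uni : ∀ x y z w, x ≠ y → H.Adj x z → H.Adj y z → H.Adj x w → H.Adj y w → z = w) :
    Nonempty (H ≃g petersen) := by
  have hnb : ∀ x, ∃ a b c, a ≠ b ∧ a ≠ c ∧ b ≠ c ∧ ∀ y, H.Adj x y ↔ y = a ∨ y = b ∨ y = c := by
    intro x
    have := h3 x
    rw [← SimpleGraph.card_neighborFinset_eq_degree, Finset.card_eq_three] at this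
    obtain ⟨a, b, c, h1, h2, h4, h5⟩ := this
    refine ⟨a, b, c, h1, h2, h4, fun y => ?_⟩
    rw [← SimpleGraph.mem_neighborFinset, h5]; simp
  obtain ⟨v⟩ : Nonempty V := Fintype.card_pos_iff.1 (by omega)
  obtain ⟨a, b, c, hab, hac, hbc, hv⟩ := hnb v
  have va : H.Adj v a := by rw [hv]; tauto
  have vb : H.Adj v b := by rw [hv]; tauto
  have vc : H.Adj v c := by rw [hv]; tauto
  have nab : ¬ H.Adj a b := fun h => tri v a b va h vb
  have nac : ¬ H.Adj a c := fun h => tri v a c va h vc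
  have nbc : ¬ H.Adj b c := fun h => tri v b c vb h vc
  have hex : ∃ a1 a2, a1 ≠ a2 ∧ a1 ≠ v ∧ a2 ≠ v ∧ H.Adj a a1 ∧ H.Adj a a2 := by
    obtain ⟨x, y, z, h1, h2, h4, h5⟩ := hnb a
    have := (h5 v).1 va.symm
    rcases this with rfl | rfl | rfl
    · exact ⟨y, z, h4, h1.symm, h2.symm, by rw [h5]; tauto, by rw [h5]; tauto⟩
    · exact ⟨x, z, h2, h1, h4.symm, by rw [h5]; tauto, by rw [h5]; tauto⟩
    · exact ⟨x, y, h1, h2, h4, by rw [h5]; tauto, by rw [h5]; tauto⟩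
  obtain ⟨a1, a2, h12, h1v, h2v, aa1, aa2⟩ := hex
  have na12 : ¬ H.Adj a1 a2 := fun h => tri a a1 a2 aa1 h aa2
  have nva1 : ¬ H.Adj v a1 := fun h => tri v a a1 va aa1 h
  have nva2 : ¬ H.Adj v a2 := fun h => tri v a a2 va aa2 h
  have na1b : ¬ H.Adj a1 b := fun h => h1v (uni a b a1 v hab aa1 h.symm va.symm vb.symm)
  have na2b : ¬ H.Adj a2 b := fun h => h2v (uni a b a2 v hab aa2 h.symm va.symm vb.symm)
  have na1c : ¬ H.Adj a1 c := fun h => h1v (uni a c a1 v hac aa1 h.symm va.symm vc.symm)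
  have na2c : ¬ H.Adj a2 c := fun h => h2v (uni a c a2 v hac aa2 h.symm va.symm vc.symm)
  have a1b' : a1 ≠ b := by rintro rfl; exact nab aa1
  have a2b' : a2 ≠ b := by rintro rfl; exact nab aa2
  have a1c' : a1 ≠ c := by rintro rfl; exact nac aa1
  have a2c' : a2 ≠ c := by rintro rfl; exact nac aa2
  obtain ⟨b1, a1b1, bb1⟩ := diam a1 b a1b' na1b
  obtain ⟨b2, a2b2, bb2⟩ := diam a2 b a2b' na2b
  obtain ⟨c1, a1c1, cc1⟩ := diam a1 c a1c' na1c
  obtain ⟨c2, a2c2, cc2⟩ := diam a2 c a2c' na2c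
  have b1v : b1 ≠ v := by rintro rfl; exact nva1 a1b1.symm
  have b2v : b2 ≠ v := by rintro rfl; exact nva2 a2b2.symm
  have c1v : c1 ≠ v := by rintro rfl; exact nva1 a1c1.symm
  have c2v : c2 ≠ v := by rintro rfl; exact nva2 a2c2.symm
  have b1a : b1 ≠ a := by rintro rfl; exact nab bb1.symm
  have b2a : b2 ≠ a := by rintro rfl; exact nab bb2.symm
  have c1a : c1 ≠ a := by rintro rfl; exact nac cc1.symm
  have c2a : c2 ≠ a := by rintro rfl; exact nac cc2.symm
  have b1c : b1 ≠ c := by rintro rfl; exact nbc bb1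
  have b2c : b2 ≠ c := by rintro rfl; exact nbc bb2
  have c1b : c1 ≠ b := by rintro rfl; exact nbc cc1.symm
  have c2b : c2 ≠ b := by rintro rfl; exact nbc cc2.symm
  have b1a2 : b1 ≠ a2 := by rintro rfl; exact na12 a1b1
  have c1a2 : c1 ≠ a2 := by rintro rfl; exact na12 a1c1
  have b2a1 : b2 ≠ a1 := by rintro rfl; exact na12 a2b2.symm
  have c2a1 : c2 ≠ a1 := by rintro rfl; exact na12 a2c2.symm
  have b12 : b1 ≠ b2 := by
    rintro rfl; exact b1a (uni a1 a2 b1 a h12 a1b1 a2b2 aa1.symm aa2.symm)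
  have c12 : c1 ≠ c2 := by
    rintro rfl; exact c1a (uni a1 a2 c1 a h12 a1c1 a2c2 aa1.symm aa2.symm)
  have hbcn : ∀ x, H.Adj b x → H.Adj c x → x = v := fun x h1 h2 =>
    uni b c x v hbc h1 h2 vb.symm vc.symm
  have b1c1 : b1 ≠ c1 := by rintro rfl; exact b1v (hbcn _ bb1 cc1)
  have b1c2 : b1 ≠ c2 := by rintro rfl; exact b1v (hbcn _ bb1 cc2)
  have b2c1 : b2 ≠ c1 := by rintro rfl; exact b2v (hbcn _ bb2 cc1)
  have b2c2 : b2 ≠ c2 := by rintro rfl; exact b2v (hbcn _ bb2 cc2)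
  have hcn : ∀ y, H.Adj c y → y = v ∨ y = c1 ∨ y = c2 := by
    intro y hy
    obtain ⟨x, y, z, h1, h2, h4, h5⟩ := hnb c
    have := (h5 v).1 vc.symm
    have := (h5 c1).1 cc1
    have := (h5 c2).1 cc2
    grind
  have nvb1 : ¬ H.Adj v b1 := fun h => tri v b b1 vb bb1 h
  have nvb2 : ¬ H.Adj v b2 := fun h => tri v b b2 vb bb2 h
  have e1 : H.Adj b1 c2 := by
    obtain ⟨z, hz1, hz2⟩ := diam b1 c b1c (fun h => b1v (hbcn _ bb1 h.symm))
    rcases hcn z hz2 with rfl | rfl | rfl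
    · exact absurd hz1.symm nvb1
    · exact absurd (tri a1 b1 z a1b1 hz1 a1c1) id
    · exact hz1
  have e2 : H.Adj b2 c1 := by
    obtain ⟨z, hz1, hz2⟩ := diam b2 c b2c (fun h => b2v (hbcn _ bb2 h.symm))
    rcases hcn z hz2 with rfl | rfl | rfl
    · exact absurd hz1.symm nvb2
    · exact hz1
    · exact absurd (tri a2 b2 z a2b2 hz1 a2c2) id
  set f : Fin 10 → V := ![v, a, b, c, a1, a2, b1, b2, c1, c2] with hf
  have finj : Function.Injective f := by
    rw [← List.nodup_ofFn]
    simp only [hf, List.ofFn_succ, List.ofFn_zero, Matrix.cons_val_zero, Matrix.cons_val_succ,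
      List.nodup_cons, List.mem_cons, List.not_mem_nil, not_or, List.nodup_nil, or_false,
      not_false_eq_true, and_true]
    have := va.ne
    have := vb.ne
    have := vc.ne
    have := aa1.ne
    have := aa2.ne
    have := bb1.ne
    have := bb2.ne
    have := cc1.ne
    have := cc2.ne
    have := a1b1.ne
    have := a1c1.ne
    have := a2b2.ne
    have := a2c2.ne
    grind
  have fadj : ∀ i k, H.Adj (f i) (f (pnb i k)) := by
    intro i k
    fin_cases i <;> fin_cases k <;>
      first
      | assumption
      | (apply SimpleGraph.Adj.symm; assumption)
  have fbij : Function.Bijective f := by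
    rw [Fintype.bijective_iff_injective_and_card]
    exact ⟨finj, by simp [hc]⟩
  have hiff : ∀ i j, H.Adj (f i) (f j) ↔ petersen.Adj (pg i) (pg j) := by
    intro i j
    rw [pg_adj]
    constructor
    · intro h
      have hsub : Finset.univ.image (fun k => f (pnb i k)) ⊆ H.neighborFinset (f i) := by
        intro y hy
        simp only [Finset.mem_image, Finset.mem_univ, true_and] at hy
        obtain ⟨k, rfl⟩ := hy
        simpa using fadj i k
      have hcard : (Finset.univ.image (fun k => f (pnb i k))).card = 3 := by
        rw [Finset.card_image_of_injective _
          (show Function.Injective (fun k => f (pnb i k)) from finj.comp (pnb_inj i))]; simp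
      have := Finset.eq_of_subset_of_card_le hsub (by
        rw [hcard, SimpleGraph.card_neighborFinset_eq_degree, h3])
      have hj : f j ∈ Finset.univ.image (fun k => f (pnb i k)) := by
        rw [this]; simpa using h
      simp only [Finset.mem_image, Finset.mem_univ, true_and] at hj
      obtain ⟨k, hk⟩ := hj
      exact ⟨k, finj hk⟩
    · rintro ⟨k, rfl⟩
      exact fadj i k
  refine ⟨⟨(Equiv.ofBijective f fbij).symm.trans (Equiv.ofBijective pg pg_bij), ?_⟩⟩
  intro x y
  obtain ⟨i, rfl⟩ := fbij.2 x
  obtain ⟨j, rfl⟩ := fbij.2 y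
  simp only [Equiv.trans_apply]
  have q : ∀ i, (Equiv.ofBijective f fbij).symm (f i) = i := fun i =>
    (Equiv.ofBijective f fbij).symm_apply_apply i
  rw [q, q]
  exact (hiff i j).symm

open Classical in
lemma case_three {V : Type} [Fintype V] (H : SimpleGraph V)
    (diam : ∀ x y, x ≠ y → ¬ H.Adj x y → ∃ z, H.Adj x z ∧ H.Adj y z)
    (hmin : ∀ x, 3 ≤ H.degree x) :
    2 * Fintype.card V ≤ H.edgeFinset.card + 5 ∧
    (H.edgeFinset.card + 5 = 2 * Fintype.card V → Nonempty (H ≃g petersen)) := by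
  by_cases hv : ∃ v, H.degree v = 3
  swap
  · push Not at hv
    have h4 : ∀ x, 4 ≤ H.degree x := fun x => by have := hmin x; have := hv x; omega
    have hs := H.sum_degrees_eq_twice_card_edges
    have : ∑ x : V, 4 ≤ ∑ x, H.degree x := Finset.sum_le_sum fun y _ => h4 y
    simp only [Finset.sum_const, Finset.card_univ, smul_eq_mul] at this
    constructor
    · omega
    · intro; omega
  obtain ⟨v, hv⟩ := hv
  have hloc := case_three_local H diam hmin
  refine ⟨by have := (hloc v hv).1; omega, fun heq => ?_⟩
  have hloc' := fun v hv => (hloc v hv).2 (by omega)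
  have hall : ∀ x, H.degree x = 3 := by
    intro x
    obtain ⟨k1, k2, k3, k4⟩ := hloc' v hv
    by_cases hxv : x = v
    · rw [hxv, hv]
    by_cases hadj : H.Adj v x
    swap
    · exact k1 x hxv hadj
    by_contra hne
    have hall' : ∀ r, r ≠ v → ¬ H.Adj v r → H.Adj x r := by
      intro r hr hr'
      by_contra hcon
      exact hne ((hloc' r (k1 r hr hr')).1 x (by rintro rfl; exact hr' hadj)
        (fun hh => hcon hh.symm))
    have hdx : Fintype.card V ≤ H.degree x + 3 := by
      have hsub : (Finset.univ : Finset V) ⊆ H.neighborFinset x ∪ H.neighborFinset v := by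
        intro r _
        simp only [Finset.mem_union, SimpleGraph.mem_neighborFinset]
        by_cases hr : r = v
        · subst hr; exact Or.inl hadj.symm
        by_cases hr' : H.Adj v r
        · exact Or.inr hr'
        · exact Or.inl (hall' r hr hr')
      have h1 := Finset.card_le_card hsub
      have h2 := Finset.card_union_le (H.neighborFinset x) (H.neighborFinset v)
      rw [SimpleGraph.card_neighborFinset_eq_degree, SimpleGraph.card_neighborFinset_eq_degree,
        hv] at h2
      rw [Finset.card_univ] at h1
      omega
    have hxN : x ∈ H.neighborFinset v := by simpa using hadj
    rw [← Finset.add_sum_erase _ _ hxN] at k2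
    have : ∑ y ∈ (H.neighborFinset v).erase x, 3 ≤ ∑ y ∈ (H.neighborFinset v).erase x, H.degree y :=
      Finset.sum_le_sum fun y _ => hmin y
    rw [Finset.sum_const, Finset.card_erase_of_mem hxN,
      SimpleGraph.card_neighborFinset_eq_degree, hv] at this
    simp only [smul_eq_mul] at this
    omega
  have hs := H.sum_degrees_eq_twice_card_edges
  simp only [hall, Finset.sum_const, Finset.card_univ, smul_eq_mul] at hs
  refine petersen_iso H (by omega) hall diam ?_ ?_
  · intro x y z hxy hyz hxz
    have := (hloc' x (hall x)).2.2.1 y hxy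
    have hz : z ∈ H.neighborFinset x ∩ H.neighborFinset y := by simp [hxz, hyz]
    rw [this] at hz
    simp at hz
  · intro x y z w hne hxz hyz hxw hyw
    by_cases hadj : H.Adj x y
    · have := (hloc' x (hall x)).2.2.1 y hadj
      have hz : z ∈ H.neighborFinset x ∩ H.neighborFinset y := by simp [hxz, hyz]
      rw [this] at hz
      simp at hz
    · have := (hloc' x (hall x)).2.2.2 y hne.symm hadj
      exact Finset.card_le_one.1 this.le z (by simp [hxz, hyz]) w (by simp [hxw, hyw])


open Classical in
lemma C5S.iso {V : Type} [Fintype V] {H : SimpleGraph V} (h : C5S H) :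
    ∃ a b c : ℕ, a + b + c + 3 = Fintype.card V ∧ Nonempty (H ≃g Habc a b c) := by
  obtain ⟨w, u1, u2, hw2, h12, hw1, n12, nw2, hz, hind⟩ := h
  have hw1' := hw1.ne
  set B : Finset V := Finset.univ.filter fun z => z ≠ w ∧ z ≠ u1 ∧ z ≠ u2 ∧ H.Adj w z with hB
  set C : Finset V := Finset.univ.filter fun z => z ≠ w ∧ z ≠ u1 ∧ z ≠ u2 ∧ ¬ H.Adj w z with hC
  have mB : ∀ z, z ∈ B ↔ z ≠ w ∧ z ≠ u1 ∧ z ≠ u2 ∧ H.Adj w z := by intro z; simp [hB]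
  have mC : ∀ z, z ∈ C ↔ z ≠ w ∧ z ≠ u1 ∧ z ≠ u2 ∧ ¬ H.Adj w z := by intro z; simp [hC]
  let f : Fin 3 ⊕ (Fin 0 ⊕ Fin B.card ⊕ Fin C.card) → V
    | Sum.inl i => ![w, u1, u2] i
    | Sum.inr (Sum.inl i) => i.elim0
    | Sum.inr (Sum.inr (Sum.inl i)) => (B.equivFin.symm i).1
    | Sum.inr (Sum.inr (Sum.inr i)) => (C.equivFin.symm i).1
  have fB : ∀ i : Fin B.card, (B.equivFin.symm i).1 ∈ B := fun i => (B.equivFin.symm i).2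
  have fC : ∀ i : Fin C.card, (C.equivFin.symm i).1 ∈ C := fun i => (C.equivFin.symm i).2
  have f0 : f (Sum.inl 0) = w := rfl
  have f1 : f (Sum.inl 1) = u1 := rfl
  have f2 : f (Sum.inl 2) = u2 := rfl
  have f3 : ∀ i : Fin 3, (i = 0 ∧ f (Sum.inl i) = w) ∨ (i = 1 ∧ f (Sum.inl i) = u1) ∨
      (i = 2 ∧ f (Sum.inl i) = u2) := by
    intro i
    fin_cases i
    · exact Or.inl ⟨rfl, rfl⟩
    · exact Or.inr (Or.inl ⟨rfl, rfl⟩)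
    · exact Or.inr (Or.inr ⟨rfl, rfl⟩)
  have fb : ∀ i, f (Sum.inr (Sum.inr (Sum.inl i))) = (B.equivFin.symm i).1 := fun i => rfl
  have fc : ∀ i, f (Sum.inr (Sum.inr (Sum.inr i))) = (C.equivFin.symm i).1 := fun i => rfl
  have finj : Function.Injective f := by
    rintro (i | i | i | i) (j | j | j | j) hij
    all_goals try exact i.elim0
    all_goals try exact j.elim0
    · rcases f3 i with ⟨rfl, h⟩ | ⟨rfl, h⟩ | ⟨rfl, h⟩ <;>
        rcases f3 j with ⟨rfl, h'⟩ | ⟨rfl, h'⟩ | ⟨rfl, h'⟩ <;>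
        first
        | rfl
        | (rw [h, h'] at hij; exact absurd hij (by tauto))
        | (rw [h, h'] at hij; exact absurd hij.symm (by tauto))
    · have := (mB _).1 (fB j)
      rw [fb] at hij
      rw [← hij] at this
      rcases f3 i with ⟨_, h⟩ | ⟨_, h⟩ | ⟨_, h⟩ <;> rw [h] at this <;> tauto
    · have := (mC _).1 (fC j)
      rw [fc] at hij
      rw [← hij] at this
      rcases f3 i with ⟨_, h⟩ | ⟨_, h⟩ | ⟨_, h⟩ <;> rw [h] at this <;> tauto
    · have := (mB _).1 (fB i)
      rw [fb] at hij
      rw [hij] at this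
      rcases f3 j with ⟨_, h⟩ | ⟨_, h⟩ | ⟨_, h⟩ <;> rw [h] at this <;> tauto
    · rw [fb, fb] at hij
      rw [B.equivFin.symm.injective (Subtype.ext hij)]
    · rw [fb, fc] at hij
      have q1 := (mB _).1 (fB i)
      have q2 := (mC _).1 (fC j)
      rw [hij] at q1
      exact absurd q1.2.2.2 q2.2.2.2
    · have := (mC _).1 (fC i)
      rw [fc] at hij
      rw [hij] at this
      rcases f3 j with ⟨_, h⟩ | ⟨_, h⟩ | ⟨_, h⟩ <;> rw [h] at this <;> tauto
    · rw [fb, fc] at hij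
      have q1 := (mB _).1 (fB j)
      have q2 := (mC _).1 (fC i)
      rw [hij] at q2
      exact absurd q1.2.2.2 q2.2.2.2
    · rw [fc, fc] at hij
      rw [C.equivFin.symm.injective (Subtype.ext hij)]
  have fsurj : Function.Surjective f := by
    intro z
    by_cases h0 : z = w
    · exact ⟨Sum.inl 0, h0.symm⟩
    by_cases h1 : z = u1
    · exact ⟨Sum.inl 1, h1.symm⟩
    by_cases h2 : z = u2
    · exact ⟨Sum.inl 2, h2.symm⟩
    by_cases h3 : H.Adj w z
    · refine ⟨Sum.inr (Sum.inr (Sum.inl (B.equivFin ⟨z, (mB z).2 ⟨h0, h1, h2, h3⟩⟩))), ?_⟩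
      rw [fb]; simp
    · refine ⟨Sum.inr (Sum.inr (Sum.inr (C.equivFin ⟨z, (mC z).2 ⟨h0, h1, h2, h3⟩⟩))), ?_⟩
      rw [fc]; simp
  clear_value f
  have fbij : Function.Bijective f := ⟨finj, fsurj⟩
  let e := Equiv.ofBijective f fbij
  refine ⟨0, B.card, C.card, ?_, ⟨(⟨e, ?_⟩ : Habc 0 B.card C.card ≃g H).symm⟩⟩
  · have := Fintype.card_congr e
    simp at this
    omega
  · intro x y
    show H.Adj (f x) (f y) ↔ _
    have hBz : ∀ i : Fin B.card, H.Adj u2 (B.equivFin.symm i).1 ∧ H.Adj w (B.equivFin.symm i).1 ∧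
        ¬ H.Adj u1 (B.equivFin.symm i).1 := fun i => by
      have q := (mB _).1 (fB i)
      have := hz _ q.1 q.2.1 q.2.2.1
      tauto
    have hCz : ∀ i : Fin C.card, H.Adj u2 (C.equivFin.symm i).1 ∧ ¬ H.Adj w (C.equivFin.symm i).1 ∧
        H.Adj u1 (C.equivFin.symm i).1 := fun i => by
      have q := (mC _).1 (fC i)
      have := hz _ q.1 q.2.1 q.2.2.1
      tauto
    have hBC : ∀ z z', (z ∈ B ∨ z ∈ C) → (z' ∈ B ∨ z' ∈ C) → ¬ H.Adj z z' := by
      intro z z' h1 h2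
      rw [mB, mC] at h1 h2
      exact hind z z' (by tauto) (by tauto) (by tauto) (by tauto) (by tauto) (by tauto)
    have n21 : ¬ H.Adj u2 u1 := fun h => n12 h.symm
    have n2w : ¬ H.Adj u2 w := fun h => nw2 h.symm
    have h1w := hw1.symm
    rcases x with i | i | i | i <;> rcases y with j | j | j | j
    all_goals try exact i.elim0
    all_goals try exact j.elim0
    · rcases f3 i with ⟨rfl, h⟩ | ⟨rfl, h⟩ | ⟨rfl, h⟩ <;>
        rcases f3 j with ⟨rfl, h'⟩ | ⟨rfl, h'⟩ | ⟨rfl, h'⟩ <;> simp only [h, h'] <;>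
        simp [Habc, n21, n2w, h1w, hw1, n12, nw2]
    · have := hBz j
      rw [fb]
      rcases f3 i with ⟨rfl, h⟩ | ⟨rfl, h⟩ | ⟨rfl, h⟩ <;> rw [h] <;> simp [Habc, this]
    · have := hCz j
      rw [fc]
      rcases f3 i with ⟨rfl, h⟩ | ⟨rfl, h⟩ | ⟨rfl, h⟩ <;> rw [h] <;> simp [Habc, this]
    · have := hBz i
      rw [H.adj_comm, fb]
      rcases f3 j with ⟨rfl, h⟩ | ⟨rfl, h⟩ | ⟨rfl, h⟩ <;> rw [h] <;> simp [Habc, this]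
    · rw [fb, fb]
      simp [Habc, hBC _ _ (Or.inl (fB i)) (Or.inl (fB j))]
    · rw [fb, fc]
      simp [Habc, hBC _ _ (Or.inl (fB i)) (Or.inr (fC j))]
    · have := hCz i
      rw [H.adj_comm, fc]
      rcases f3 j with ⟨rfl, h⟩ | ⟨rfl, h⟩ | ⟨rfl, h⟩ <;> rw [h] <;> simp [Habc, this]
    · rw [fc, fb]
      simp [Habc, hBC _ _ (Or.inr (fC i)) (Or.inl (fB j))]
    · rw [fc, fc]
      simp [Habc, hBC _ _ (Or.inr (fC i)) (Or.inr (fC j))]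


open Classical in
lemma tri_contra {s t : ℕ} {V : Type} [Fintype V] (hV : Fintype.card V = t + 2)
    (hbeta : (t+1)/(s+1) ≤ 2) {G : SimpleGraph V} (hprop : HasSTProp s t G)
    (h : TriS Gᶜ) : False := by
  obtain ⟨b, a, x, y, hba, hbx, hby, hax, hay, hxy, na, nx, ny, hcl, hind⟩ := h
  have main : ∀ a' x' y' : V, b ≠ a' → x' ≠ b → x' ≠ a' → ¬ Gᶜ.Adj b a' → ¬ Gᶜ.Adj b x' →
      ¬ Gᶜ.Adj b y' →
      (∀ z, z ≠ b → z ≠ a' → z ≠ x' → z ≠ y' → Gᶜ.Adj a' z →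
        ¬ Gᶜ.Adj x' z ∧ ¬ Gᶜ.Adj y' z) →
      (∀ z z', z ≠ b → z ≠ a' → z ≠ x' → z ≠ y' → z' ≠ b → z' ≠ a' → z' ≠ x' → z' ≠ y' →
        ¬ Gᶜ.Adj z z') →
      s ≤ (Finset.univ.filter fun z => z ≠ b ∧ z ≠ a' ∧ z ≠ x' ∧ z ≠ y' ∧ Gᶜ.Adj a' z).card := by
    intro a' x' y' h1 h2 h2' h3 h4 h5 h6 h7
    have hG : ∀ z w, z ≠ w → ¬ Gᶜ.Adj z w → G.Adj z w := by
      intro z w hzw hh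
      by_contra hcon
      exact hh (by rw [SimpleGraph.compl_adj]; exact ⟨hzw, hcon⟩)
    refine minor_key hV hprop (hG b a' h1 h3) _ (by simp) (by simp) ?_ ?_ ?_
    · intro z hz w hw hwb hwa
      simp only [Finset.mem_filter, Finset.mem_univ, true_and] at hz hw
      obtain ⟨z1, z2, z3, z4, z5⟩ := hz
      have h6z := h6 z z1 z2 z3 z4 z5
      by_cases hwx : w = x'
      · subst hwx
        exact (hG _ _ z3.symm h6z.1).symm
      by_cases hwy : w = y'
      · subst hwy
        exact (hG _ _ z4.symm h6z.2).symm
      have hzw : z ≠ w := by rintro rfl; tauto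
      exact hG _ _ hzw (h7 z w z1 z2 z3 z4 hwb hwa hwx hwy)
    · intro w hw hwb hwa
      simp only [Finset.mem_filter, Finset.mem_univ, true_and] at hw
      by_cases hwx : w = x'
      · subst hwx
        exact Or.inl (hG _ _ hwb.symm h4)
      by_cases hwy : w = y'
      · subst hwy
        exact Or.inl (hG _ _ hwb.symm h5)
      exact Or.inr (hG _ _ hwa.symm (by tauto))
    · exact ⟨x', by simp, h2, h2'⟩
  have m1 := main a x y hba hbx.symm hax.symm na nx ny
    (fun z z1 z2 z3 z4 z5 => by have := hcl z z1 z2 z3 z4; tauto) hind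
  have m2 := main x a y hbx hba.symm hax nx na ny
    (fun z z1 z2 z3 z4 z5 => by have := hcl z z1 z3 z2 z4; tauto)
    (fun z z' z1 z2 z3 z4 w1 w2 w3 w4 => hind z z' z1 z3 z2 z4 w1 w3 w2 w4)
  have m3 := main y a x hby hba.symm hay ny na nx
    (fun z z1 z2 z3 z4 z5 => by have := hcl z z1 z3 z4 z2; tauto)
    (fun z z' z1 z2 z3 z4 w1 w2 w3 w4 => hind z z' z1 z3 z4 z2 w1 w3 w4 w2)
  set T1 := Finset.univ.filter fun z => z ≠ b ∧ z ≠ a ∧ z ≠ x ∧ z ≠ y ∧ Gᶜ.Adj a z with hT1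
  set T2 := Finset.univ.filter fun z => z ≠ b ∧ z ≠ x ∧ z ≠ a ∧ z ≠ y ∧ Gᶜ.Adj x z with hT2
  set T3 := Finset.univ.filter fun z => z ≠ b ∧ z ≠ y ∧ z ≠ a ∧ z ≠ x ∧ Gᶜ.Adj y z with hT3
  have d12 : Disjoint T1 T2 := by
    rw [Finset.disjoint_left]
    intro z h1 h2
    simp only [hT1, hT2, Finset.mem_filter, Finset.mem_univ, true_and] at h1 h2
    have := hcl z h1.1 h1.2.1 h1.2.2.1 h1.2.2.2.1
    tauto
  have d3 : Disjoint (T1 ∪ T2) T3 := by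
    rw [Finset.disjoint_left]
    intro z h1 h2
    simp only [hT1, hT2, hT3, Finset.mem_union, Finset.mem_filter, Finset.mem_univ,
      true_and] at h1 h2
    have := hcl z h2.1 h2.2.2.1 h2.2.2.2.1 h2.2.1
    tauto
  have d4 : Disjoint (T1 ∪ T2 ∪ T3) {b, a, x, y} := by
    rw [Finset.disjoint_left]
    intro z h1 h2
    simp only [hT1, hT2, hT3, Finset.mem_union, Finset.mem_filter, Finset.mem_univ,
      true_and, Finset.mem_insert, Finset.mem_singleton] at h1 h2
    tauto
  have c4 : ({b, a, x, y} : Finset V).card = 4 := by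
    rw [Finset.card_insert_of_notMem (by simp [hba, hbx, hby]),
      Finset.card_insert_of_notMem (by simp [hax, hay]),
      Finset.card_insert_of_notMem (by simp [hxy]), Finset.card_singleton]
  have := Finset.card_le_univ (T1 ∪ T2 ∪ T3 ∪ {b, a, x, y})
  rw [Finset.card_union_of_disjoint d4, Finset.card_union_of_disjoint d3,
    Finset.card_union_of_disjoint d12, c4, hV] at this
  have hb : t + 1 < 3 * (s + 1) := by
    have := Nat.lt_mul_of_div_lt (show (t + 1) / (s + 1) < 3 by omega) (Nat.succ_pos s)
    linarith
  omega



lemma ecard_add_compl {V : Type} [Fintype V] (G : SimpleGraph V) :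
    ecard G + ecard Gᶜ = (Fintype.card V).choose 2 := by
  classical
  have hd : Disjoint G.edgeSet Gᶜ.edgeSet :=
    SimpleGraph.disjoint_edgeSet.2 disjoint_compl_right
  rw [ecard, ecard, ← Set.ncard_union_eq hd (Set.toFinite _) (Set.toFinite _),
    ← SimpleGraph.edgeSet_sup, sup_compl_eq_top,
    ← SimpleGraph.card_edgeFinset_top_eq_card_choose_two, ← SimpleGraph.coe_edgeFinset,
    Set.ncard_coe_finset]

open Classical in
lemma graph_main {V : Type} [Fintype V] (H : SimpleGraph V)
    (diam : ∀ x y, x ≠ y → ¬ H.Adj x y → ∃ z, H.Adj x z ∧ H.Adj y z)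
    (nodom : ∀ x, ∃ y, y ≠ x ∧ ¬ H.Adj x y) :
    2 * Fintype.card V ≤ ecard H + 5 ∧
    (ecard H + 5 = 2 * Fintype.card V → C5S H ∨ TriS H ∨ Nonempty (H ≃g petersen)) := by
  have hdeg2 : ∀ x, 2 ≤ H.degree x := by
    intro x
    by_contra hlt
    push Not at hlt
    have hle : (H.neighborFinset x).card ≤ 1 := by
      rw [SimpleGraph.card_neighborFinset_eq_degree]; omega
    haveI : Nonempty V := ⟨x⟩
    rw [Finset.card_le_one_iff_subset_singleton] at hle
    obtain ⟨m, hm⟩ := hle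
    have hm' : ∀ z, H.Adj x z → z = m := fun z hz => by
      have := hm (show z ∈ H.neighborFinset x by simpa using hz)
      simpa using this
    obtain ⟨y0, hy0, hy0'⟩ := nodom x
    obtain ⟨z0, hz1, hz2⟩ := diam x y0 hy0.symm hy0'
    have hxm : H.Adj x m := by rw [← hm' z0 hz1]; exact hz1
    obtain ⟨y, hy, hy'⟩ := nodom m
    have hyx : y ≠ x := by rintro rfl; exact hy' hxm.symm
    have hxy : ¬ H.Adj x y := fun hh => hy (hm' y hh)
    obtain ⟨z, h1, h2⟩ := diam x y hyx.symm hxy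
    rw [hm' z h1] at h2
    exact hy' h2.symm
  have he : ecard H = H.edgeFinset.card := by
    rw [ecard, ← SimpleGraph.coe_edgeFinset, Set.ncard_coe_finset]
  rw [he]
  by_cases h2 : ∃ v, H.degree v = 2
  · obtain ⟨v, hv⟩ := h2
    obtain ⟨k1, k2⟩ := case_two H diam nodom v hv
    refine ⟨k1, fun heq => ?_⟩
    rcases k2 heq with h | h
    · exact Or.inl h
    · exact Or.inr (Or.inl h)
  · push Not at h2
    obtain ⟨k1, k2⟩ := case_three H diam (fun x => by
      have := hdeg2 x; have := h2 x; omega)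
    exact ⟨k1, fun heq => Or.inr (Or.inr (k2 heq))⟩

/-- Lemma 3.3: connected (t+2)-vertex graphs with the (s,t)-property, for β ≤ 2. -/
theorem edge_bound_t_plus_two (s t : ℕ) (ht : 4 ≤ t) (hs : 2 ≤ s) (hst : s ≤ t)
    (hbeta : (t+1)/(s+1) ≤ 2)
    {V : Type} [Fintype V] (hV : Fintype.card V = t + 2)
    (G : SimpleGraph V) (hconn : G.Connected) (hprop : HasSTProp s t G) :
    ecard G ≤ t.choose 2 + 2 ∧
    (ecard G = t.choose 2 + 2 →
      (∃ a b c : ℕ, a + b + c = t - 1 ∧ Nonempty (Gᶜ ≃g Habc a b c)) ∨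
      Nonempty (Gᶜ ≃g petersen)) := by
  classical
  have hGadj : ∀ z w, z ≠ w → ¬ Gᶜ.Adj z w → G.Adj z w := by
    intro z w hzw hh
    by_contra hcon
    exact hh (by rw [SimpleGraph.compl_adj]; exact ⟨hzw, hcon⟩)
  have diam : ∀ x y, x ≠ y → ¬ Gᶜ.Adj x y → ∃ z, Gᶜ.Adj x z ∧ Gᶜ.Adj y z := by
    intro x y hxy hadj
    by_contra hcon
    push Not at hcon
    have := minor_key hV hprop (hGadj x y hxy hadj) ∅ (by simp) (by simp) (by simp)
      (fun z _ hzx hzy => by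
        by_cases h1 : Gᶜ.Adj x z
        · exact Or.inr (hGadj y z hzy.symm (hcon z h1))
        · exact Or.inl (hGadj x z hzx.symm h1))
      (by
        by_contra hno
        push Not at hno
        have hsub : (Finset.univ : Finset V) ⊆ {x, y} := by
          intro z _
          by_cases hz : z = x
          · simp [hz]
          · simp [hno z (by simp) hz]
        have h1 := Finset.card_le_card hsub
        have h2 := Finset.card_le_two (a := x) (b := y)
        rw [Finset.card_univ, hV] at h1
        omega)
    simp at this
    omega
  have nodom : ∀ x, ∃ y, y ≠ x ∧ ¬ Gᶜ.Adj x y := by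
    intro x
    haveI : Nontrivial V := Fintype.one_lt_card_iff_nontrivial.1 (by omega)
    obtain ⟨y, hy⟩ := hconn.preconnected.exists_adj_of_nontrivial x
    exact ⟨y, hy.ne', fun hh => by
      rw [SimpleGraph.compl_adj] at hh
      exact hh.2 hy⟩
  have hedge : ecard G + ecard Gᶜ = t.choose 2 + 2 * t + 1 := by
    rw [ecard_add_compl, hV, Nat.choose_succ_succ' (t + 1) 1, Nat.choose_succ_succ' t 1]
    simp
    omega
  obtain ⟨k1, k2⟩ := graph_main Gᶜ diam nodom
  rw [hV] at k1 k2
  refine ⟨by omega, fun heq => ?_⟩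
  rcases k2 (by omega) with h | h | h
  · left
    obtain ⟨a, b, c, habc, hiso⟩ := h.iso
    exact ⟨a, b, c, by omega, hiso⟩
  · exact absurd (tri_contra hV hbeta hprop h) id
  · exact Or.inr h
end
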